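/- arXiv:2207.05998 — 14 statements merged into one kernel-verified Lean document; each statement's English description precedes it below -/
import Mathlib

section
/- A set B ⊆ T∞ is biclosed if and only if there exists a strict total order ≺ on ℤ such that B = {(i,j) ∈ T∞ : j ≺ i}. -/
/-- `T∞ = {(i,j) ∈ ℤ × ℤ : i < j}`. -/
def Tinf : Set (ℤ × ℤ) := {p | p.1 < p.2}

/-- A subset `B ⊆ T∞` is closed if whenever `i < j < k` with `(i,j) ∈ B` and
`(j,k) ∈ B`, also `(i,k) ∈ B`. -/
def IsClosedA (B : Set (ℤ × ℤ)) : Prop :=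
  B ⊆ Tinf ∧ ∀ i j k : ℤ, i < j → j < k → (i, j) ∈ B → (j, k) ∈ B → (i, k) ∈ B

/-- `B` is coclosed if `T∞ \ B` is closed. -/
def IsCoclosedA (B : Set (ℤ × ℤ)) : Prop :=
  B ⊆ Tinf ∧ IsClosedA (Tinf \ B)

/-- `B` is biclosed if it is both closed and coclosed. -/
def IsBiclosedA (B : Set (ℤ × ℤ)) : Prop :=
  IsClosedA B ∧ IsCoclosedA B

/-- The closure of `U`: the intersection of all closed sets containing `U`. -/
def closureA (U : Set (ℤ × ℤ)) : Set (ℤ × ℤ) :=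
  ⋂₀ {K | IsClosedA K ∧ U ⊆ K}

/-- The interior of `U`: the union of all coclosed sets contained in `U`. -/
def interiorA (U : Set (ℤ × ℤ)) : Set (ℤ × ℤ) :=
  ⋃₀ {K | IsCoclosedA K ∧ K ⊆ U}

/-- A set `B ⊆ T∞` is biclosed if and only if there exists a strict total order `≺`
on `ℤ` such that `B = {(i,j) ∈ T∞ : j ≺ i}`. -/
theorem biclosed_iff_exists_strictTotalOrder (B : Set (ℤ × ℤ)) (hB : B ⊆ Tinf) :
    IsBiclosedA B ↔
      ∃ r : ℤ → ℤ → Prop, IsStrictTotalOrder ℤ r ∧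
        B = {p : ℤ × ℤ | p ∈ Tinf ∧ r p.2 p.1} := by
  constructor
  · rintro ⟨⟨_, hc⟩, _, _, hcc⟩
    have hcc' : ∀ i j k : ℤ, i < j → j < k → (i, j) ∉ B → (j, k) ∉ B → (i, k) ∉ B :=
      fun i j k hij hjk h1 h2 => (hcc i j k hij hjk ⟨hij, h1⟩ ⟨hjk, h2⟩).2
    refine ⟨fun a b => (a < b ∧ (a, b) ∉ B) ∨ (b < a ∧ (b, a) ∈ B), ?_, ?_⟩
    · refine { trichotomous := ?_, irrefl := ?_, trans := ?_ }
      · intro a b h1 h2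
        rcases lt_trichotomy a b with h | h | h
        · by_cases hm : (a, b) ∈ B
          · exact absurd (Or.inr ⟨h, hm⟩) h2
          · exact absurd (Or.inl ⟨h, hm⟩) h1
        · exact h
        · by_cases hm : (b, a) ∈ B
          · exact absurd (Or.inr ⟨h, hm⟩) h1
          · exact absurd (Or.inl ⟨h, hm⟩) h2
      · intro a h
        rcases h with h | h <;> exact lt_irrefl _ h.1
      · intro a b c h1 h2
        have e1 := hc a c b
        have e2 := hc b a c
        have e3 := hc c b a
        have e4 := hc b c a
        have e5 := hc c a b
        have f1 := hcc' a b c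
        have f2 := hcc' a c b
        have f3 := hcc' b a c
        have f4 := hcc' b c a
        have f5 := hcc' c a b
        rcases lt_trichotomy a c with h | h | h
        · grind
        · subst h
          grind
        · grind
    · ext ⟨i, j⟩
      constructor
      · intro h
        exact ⟨hB h, Or.inr ⟨hB h, h⟩⟩
      · rintro ⟨h, h' | h'⟩
        · exact absurd (lt_trans h h'.1) (lt_irrefl _)
        · exact h'.2
  · rintro ⟨r, hr, rfl⟩
    refine ⟨⟨hB, ?_⟩, hB, Set.diff_subset, ?_⟩
    · intro i j k hij hjk h1 h2
      exact ⟨lt_trans hij hjk, _root_.trans h2.2 h1.2⟩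
    · intro i j k hij hjk h1 h2
      refine ⟨lt_trans hij hjk, fun h => ?_⟩
      have g1 : r i j := by
        rcases trichotomous_of r i j with g | g | g
        · exact g
        · exact absurd g hij.ne
        · exact absurd ⟨hij, g⟩ h1.2
      have g2 : r j k := by
        rcases trichotomous_of r j k with g | g | g
        · exact g
        · exact absurd g hjk.ne
        · exact absurd ⟨hjk, g⟩ h2.2
      exact irrefl_of r i (_root_.trans (_root_.trans g1 g2) h.2)
end

section
/- If U ⊆ T∞ is coclosed, then the closure of U is biclosed; and if K ⊆ T∞ is closed, then the interior of K is biclosed. -/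
theorem closedA_closureA {U : Set (ℤ × ℤ)} (h : U ⊆ Tinf) : IsClosedA (closureA U) := by
  refine ⟨?_, ?_⟩
  · intro p hp
    exact hp Tinf ⟨⟨subset_rfl, fun i j k hij hjk _ _ => lt_trans hij hjk⟩, h⟩
  · intro i j k hij hjk h1 h2 K hK
    exact hK.1.2 i j k hij hjk (h1 K hK) (h2 K hK)

theorem subset_closureA (U : Set (ℤ × ℤ)) : U ⊆ closureA U :=
  fun _ hp _ hK => hK.2 hp

theorem biclosedA_closureA {U : Set (ℤ × ℤ)} (h : IsCoclosedA U) :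
    IsBiclosedA (closureA U) := by
  have hc := closedA_closureA h.1
  have hs := subset_closureA U
  have key : closureA U ⊆ {p | p ∈ closureA U ∧
      ∀ j, p.1 < j → j < p.2 → (p.1, j) ∈ closureA U ∨ (j, p.2) ∈ closureA U} := by
    intro p hp
    refine hp _ ⟨⟨fun q hq => hc.1 hq.1, ?_⟩, ?_⟩
    · rintro i b k hib hbk ⟨h1, h1'⟩ ⟨h2, h2'⟩
      refine ⟨hc.2 i b k hib hbk h1 h2, ?_⟩
      intro j hij hjk
      simp only at hij hjk h1' h2' ⊢
      rcases lt_trichotomy j b with hjb | rfl | hjb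
      · rcases h1' j hij hjb with h3 | h3
        · exact Or.inl h3
        · exact Or.inr (hc.2 j b k hjb hbk h3 h2)
      · exact Or.inl h1
      · rcases h2' j hjb hjk with h3 | h3
        · exact Or.inl (hc.2 i b j hib hjb h1 h3)
        · exact Or.inr h3
    · rintro ⟨i, k⟩ hq
      refine ⟨hs hq, ?_⟩
      intro j hij hjk
      simp only at hij hjk ⊢
      by_contra hcon
      push Not at hcon
      exact (h.2.2 i j k hij hjk ⟨hij, fun hh => hcon.1 (hs hh)⟩
        ⟨hjk, fun hh => hcon.2 (hs hh)⟩).2 hq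
  refine ⟨hc, hc.1, Set.sdiff_subset, ?_⟩
  intro i j k hij hjk h1 h2
  refine ⟨lt_trans hij hjk, fun hik => ?_⟩
  rcases (key hik).2 j hij hjk with h3 | h3
  · exact h1.2 h3
  · exact h2.2 h3

theorem tinf_diff_diff {U : Set (ℤ × ℤ)} (h : U ⊆ Tinf) : Tinf \ (Tinf \ U) = U :=
  Set.sdiff_sdiff_cancel_left h

theorem interiorA_eq {K : Set (ℤ × ℤ)} (hK : K ⊆ Tinf) :
    interiorA K = Tinf \ closureA (Tinf \ K) := by
  have hc := closedA_closureA (U := Tinf \ K) Set.sdiff_subset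
  apply Set.Subset.antisymm
  · rintro p ⟨V, ⟨hV, hVK⟩, hp⟩
    refine ⟨hV.1 hp, fun hcl => ?_⟩
    exact (hcl (Tinf \ V) ⟨hV.2, Set.sdiff_subset_sdiff_right hVK⟩).2 hp
  · intro p hp
    refine ⟨_, ⟨⟨Set.sdiff_subset, ?_⟩, ?_⟩, hp⟩
    · rw [tinf_diff_diff hc.1]; exact hc
    · intro q hq
      by_contra hqK
      exact hq.2 (subset_closureA _ ⟨hq.1, hqK⟩)

/-- If `U ⊆ T∞` is coclosed, then the closure of `U` is biclosed; and if
`K ⊆ T∞` is closed, then the interior of `K` is biclosed. -/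
theorem closure_of_coclosed_isBiclosed_and_interior_of_closed_isBiclosed :
    (∀ U : Set (ℤ × ℤ), IsCoclosedA U → IsBiclosedA (closureA U)) ∧
    (∀ K : Set (ℤ × ℤ), IsClosedA K → IsBiclosedA (interiorA K)) := by
  refine ⟨fun U hU => biclosedA_closureA hU, fun K hK => ?_⟩
  have hb : IsBiclosedA (closureA (Tinf \ K)) :=
    biclosedA_closureA ⟨Set.sdiff_subset, by rw [tinf_diff_diff hK.1]; exact hK⟩
  rw [interiorA_eq hK.1]
  refine ⟨hb.2.2, Set.sdiff_subset, ?_⟩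
  rw [tinf_diff_diff hb.1.1]
  exact hb.1
end

section
/- For any family 𝒳 of biclosed subsets of T∞, the closure of the union ⋃𝒳 is biclosed and is the least biclosed set containing every member of 𝒳, and the interior of the intersection ⋂𝒳 is biclosed and is the greatest biclosed set contained in every member of 𝒳; consequently, the collection of biclosed subsets of T∞, ordered by inclusion, is a complete lattice. -/
theorem cocl_iff (B : Set (ℤ × ℤ)) : IsCoclosedA B ↔ B ⊆ Tinf ∧
    ∀ i j k : ℤ, i < j → j < k → (i, k) ∈ B → (i, j) ∈ B ∨ (j, k) ∈ B := by
  constructor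
  · rintro ⟨h, -, h2⟩
    refine ⟨h, fun i j k hij hjk hik => ?_⟩
    by_contra hc
    rw [not_or] at hc
    exact (h2 i j k hij hjk ⟨hij, hc.1⟩ ⟨hjk, hc.2⟩).2 hik
  · rintro ⟨h, h2⟩
    refine ⟨h, Set.diff_subset, fun i j k hij hjk h1 h3 => ⟨hij.trans hjk, fun hik => ?_⟩⟩
    rcases h2 i j k hij hjk hik with h4 | h4
    · exact h1.2 h4
    · exact h3.2 h4

theorem closed_closureA {U : Set (ℤ × ℤ)} (hU : U ⊆ Tinf) : IsClosedA (closureA U) := by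
  refine ⟨fun p hp => hp Tinf ⟨⟨subset_rfl, fun i j k h1 h2 _ _ => h1.trans h2⟩, hU⟩, ?_⟩
  intro i j k hij hjk h1 h2 K hK
  exact hK.1.2 i j k hij hjk (h1 K hK) (h2 K hK)

theorem closureA_min {U Y : Set (ℤ × ℤ)} (hY : IsClosedA Y) (h : U ⊆ Y) : closureA U ⊆ Y :=
  fun _ hp => hp Y ⟨hY, h⟩

theorem biclosed_closureA {U : Set (ℤ × ℤ)} (hU : IsCoclosedA U) :
    IsBiclosedA (closureA U) := by
  have hc := closed_closureA hU.1
  refine ⟨hc, (cocl_iff _).2 ⟨hc.1, ?_⟩⟩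
  have hD : IsClosedA {p | p ∈ closureA U ∧ ∀ j, p.1 < j → j < p.2 →
      (p.1, j) ∈ closureA U ∨ (j, p.2) ∈ closureA U} := by
    refine ⟨fun p hp => hc.1 hp.1, ?_⟩
    rintro i m k him hmk ⟨h1, h1'⟩ ⟨h2, h2'⟩
    refine ⟨hc.2 i m k him hmk h1 h2, fun j hij hjk => ?_⟩
    dsimp only at *
    rcases lt_trichotomy j m with h | h | h
    · exact (h1' j hij h).imp id fun h3 => hc.2 j m k h hmk h3 h2
    · subst h; exact Or.inl h1
    · exact (h2' j h hjk).imp (fun h3 => hc.2 i m j him h h1 h3) id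
  intro i j k hij hjk hik
  refine (closureA_min hD (fun p hp => ⟨subset_closureA U hp, fun j h1 h2 => ?_⟩) hik).2 j hij hjk
  exact (((cocl_iff U).1 hU).2 p.1 j p.2 h1 h2 hp).imp
    (fun h => subset_closureA U h) (fun h => subset_closureA U h)

theorem cocl_sUnion {S : Set (Set (ℤ × ℤ))} (h : ∀ B ∈ S, IsCoclosedA B) :
    IsCoclosedA (⋃₀ S) := by
  refine (cocl_iff _).2 ⟨Set.sUnion_subset fun B hB => (h B hB).1, ?_⟩
  rintro i j k hij hjk ⟨B, hB, hik⟩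
  exact (((cocl_iff B).1 (h B hB)).2 i j k hij hjk hik).imp
    (fun h => ⟨B, hB, h⟩) (fun h => ⟨B, hB, h⟩)

theorem closed_compl {K : Set (ℤ × ℤ)} (h : IsClosedA K) : IsCoclosedA (Tinf \ K) := by
  refine ⟨Set.diff_subset, ?_⟩
  rwa [Set.diff_diff_cancel_left h.1]

theorem bi_compl {K : Set (ℤ × ℤ)} (h : IsBiclosedA K) : IsBiclosedA (Tinf \ K) :=
  ⟨h.2.2, closed_compl h.1⟩

theorem interiorA_eq_s3 (S : Set (Set (ℤ × ℤ))) :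
    interiorA (⋂₀ S) = Tinf \ closureA (⋃₀ ((fun B => Tinf \ B) '' S)) := by
  have hT : (⋃₀ ((fun B => Tinf \ B) '' S)) ⊆ Tinf := by
    rintro p ⟨_, ⟨B, _, rfl⟩, hp⟩
    exact hp.1
  apply Set.Subset.antisymm
  · rintro p ⟨K, ⟨hK, hKS⟩, hp⟩
    refine ⟨hK.1 hp, fun hc => (hc (Tinf \ K) ⟨hK.2, ?_⟩).2 hp⟩
    rintro q ⟨_, ⟨B, hB, rfl⟩, hq⟩
    exact ⟨hq.1, fun hqK => hq.2 (hKS hqK B hB)⟩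
  · intro p hp
    refine ⟨_, ⟨closed_compl (closed_closureA hT), ?_⟩, hp⟩
    intro q hq B hB
    by_contra hqB
    exact hq.2 (subset_closureA _ ⟨_, ⟨B, hB, rfl⟩, hq.1, hqB⟩)

theorem sup_part (S : Set (Set (ℤ × ℤ))) (h : ∀ B ∈ S, IsBiclosedA B) :
    IsBiclosedA (closureA (⋃₀ S)) ∧ (∀ B ∈ S, B ⊆ closureA (⋃₀ S)) ∧
      (∀ Y : Set (ℤ × ℤ), IsBiclosedA Y → (∀ B ∈ S, B ⊆ Y) → closureA (⋃₀ S) ⊆ Y) :=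
  ⟨biclosed_closureA (cocl_sUnion fun B hB => (h B hB).2),
    fun _ hB => (Set.subset_sUnion_of_mem hB).trans (subset_closureA _),
    fun _ hY hB => closureA_min hY.1 (Set.sUnion_subset hB)⟩

/-- For any family `𝒳` of biclosed subsets of `T∞`, the closure of `⋃𝒳` is the
least biclosed upper bound, the interior of `⋂𝒳` is the greatest biclosed lower
bound, and consequently the biclosed subsets of `T∞` ordered by inclusion form a
complete lattice. -/
theorem biclosedA_completeLattice (𝒳 : Set (Set (ℤ × ℤ)))
    (h𝒳 : ∀ B ∈ 𝒳, IsBiclosedA B) :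
    (IsBiclosedA (closureA (⋃₀ 𝒳)) ∧ (∀ B ∈ 𝒳, B ⊆ closureA (⋃₀ 𝒳)) ∧
      (∀ Y : Set (ℤ × ℤ), IsBiclosedA Y → (∀ B ∈ 𝒳, B ⊆ Y) →
        closureA (⋃₀ 𝒳) ⊆ Y)) ∧
    (IsBiclosedA (interiorA (⋂₀ 𝒳)) ∧ (∀ B ∈ 𝒳, interiorA (⋂₀ 𝒳) ⊆ B) ∧
      (∀ Y : Set (ℤ × ℤ), IsBiclosedA Y → (∀ B ∈ 𝒳, Y ⊆ B) →
        Y ⊆ interiorA (⋂₀ 𝒳))) ∧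
    (∃ _inst : CompleteLattice {B : Set (ℤ × ℤ) // IsBiclosedA B},
      ∀ X Y : {B : Set (ℤ × ℤ) // IsBiclosedA B}, X ≤ Y ↔ X.1 ⊆ Y.1) := by
  refine ⟨sup_part 𝒳 h𝒳, ⟨?_, ?_, ?_⟩, ?_⟩
  · rw [interiorA_eq_s3]
    refine bi_compl (sup_part _ ?_).1
    rintro _ ⟨B, hB, rfl⟩
    exact bi_compl (h𝒳 B hB)
  · rintro B hB p ⟨K, hK, hp⟩
    exact hK.2 hp B hB
  · intro Y hY h p hp
    exact ⟨Y, ⟨hY.2, Set.subset_sInter h⟩, hp⟩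
  · have key : ∀ S : Set {B : Set (ℤ × ℤ) // IsBiclosedA B},
        ∀ B ∈ Subtype.val '' S, IsBiclosedA B := by
      rintro S _ ⟨B, _, rfl⟩
      exact B.2
    let _ : SupSet {B : Set (ℤ × ℤ) // IsBiclosedA B} :=
      ⟨fun S => ⟨closureA (⋃₀ (Subtype.val '' S)), (sup_part _ (key S)).1⟩⟩
    refine ⟨completeLatticeOfSup _ fun S => ⟨?_, ?_⟩, fun X Y => Iff.rfl⟩
    · intro B hB
      exact (sup_part _ (key S)).2.1 B.1 ⟨B, hB, rfl⟩
    · intro Y hY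
      refine (sup_part _ (key S)).2.2 Y.1 Y.2 ?_
      rintro _ ⟨B, hB, rfl⟩
      exact hY hB
end

section
/- A set B ⊆ Tₙ is biclosed if and only if there exists a permutation σ of {1,…,n} such that B = I(σ); moreover, such a permutation σ is unique. -/
/-- `Tₙ = {(i,j) ∈ ℤ × ℤ : 1 ≤ i < j ≤ n}`. -/
def Tn (n : ℤ) : Set (ℤ × ℤ) := {p | 1 ≤ p.1 ∧ p.1 < p.2 ∧ p.2 ≤ n}

/-- A subset `B ⊆ Tₙ` is closed if whenever `i < j < k` with `(i,j) ∈ B` and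
`(j,k) ∈ B`, also `(i,k) ∈ B`. -/
def IsClosedFin (n : ℤ) (B : Set (ℤ × ℤ)) : Prop :=
  B ⊆ Tn n ∧ ∀ i j k : ℤ, i < j → j < k → (i, j) ∈ B → (j, k) ∈ B → (i, k) ∈ B

/-- `B` is coclosed if `Tₙ \ B` is closed. -/
def IsCoclosedFin (n : ℤ) (B : Set (ℤ × ℤ)) : Prop :=
  B ⊆ Tn n ∧ IsClosedFin n (Tn n \ B)

/-- `B` is biclosed if it is both closed and coclosed. -/
def IsBiclosedFin (n : ℤ) (B : Set (ℤ × ℤ)) : Prop :=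
  IsClosedFin n B ∧ IsCoclosedFin n B

/-- The order relation attached to `B`: `x` weakly precedes `y`. -/
def Prec (B : Set (ℤ × ℤ)) (x y : ℤ) : Prop :=
  x = y ∨ (x < y ∧ (x, y) ∉ B) ∨ (y < x ∧ (y, x) ∈ B)

open Classical in
/-- The rank of `x`. -/
noncomputable def rankFn (n : ℤ) (B : Set (ℤ × ℤ)) (x : ℤ) : ℤ :=
  if 1 ≤ x ∧ x ≤ n then (((Finset.Icc 1 n).filter (fun y => Prec B y x)).card : ℤ) else x

theorem prec_trans {n : ℤ} {B : Set (ℤ × ℤ)} (h : IsBiclosedFin n B) {x y z : ℤ}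
    (hx : 1 ≤ x ∧ x ≤ n) (hy : 1 ≤ y ∧ y ≤ n) (hz : 1 ≤ z ∧ z ≤ n)
    (h1 : Prec B x y) (h2 : Prec B y z) : Prec B x z := by
  obtain ⟨⟨_, hc⟩, _, _, hd⟩ := h
  have hd' : ∀ i j k : ℤ, 1 ≤ i → k ≤ n → i < j → j < k → (i, j) ∉ B → (j, k) ∉ B →
      (i, k) ∉ B := by
    intro i j k hi hk hij hjk ha hb
    exact (hd i j k hij hjk ⟨⟨hi, hij, by simp; omega⟩, ha⟩
      ⟨⟨by simp; omega, hjk, hk⟩, hb⟩).2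
  unfold Prec at *
  rcases h1 with rfl | ⟨h1, h1'⟩ | ⟨h1, h1'⟩
  · exact h2
  · rcases h2 with rfl | ⟨h2, h2'⟩ | ⟨h2, h2'⟩
    · exact Or.inr (Or.inl ⟨h1, h1'⟩)
    · exact Or.inr (Or.inl ⟨by omega, hd' x y z hx.1 hz.2 h1 h2 h1' h2'⟩)
    · rcases lt_trichotomy x z with h3 | h3 | h3
      · exact Or.inr (Or.inl ⟨h3, fun h4 => h1' (hc _ _ _ h3 h2 h4 h2')⟩)
      · exact Or.inl h3
      · refine Or.inr (Or.inr ⟨h3, ?_⟩)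
        by_contra h4
        exact hd' z x y hz.1 hy.2 h3 h1 h4 h1' h2'
  · rcases h2 with rfl | ⟨h2, h2'⟩ | ⟨h2, h2'⟩
    · exact Or.inr (Or.inr ⟨h1, h1'⟩)
    · rcases lt_trichotomy x z with h3 | h3 | h3
      · refine Or.inr (Or.inl ⟨h3, fun h4 => h2' (hc _ _ _ h1 h3 h1' h4)⟩)
      · exact Or.inl h3
      · refine Or.inr (Or.inr ⟨h3, ?_⟩)
        by_contra h4
        exact hd' y z x hy.1 hx.2 h2 h3 h2' h4 h1'
    · exact Or.inr (Or.inr ⟨by omega, hc _ _ _ h2 h1 h2' h1'⟩)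

theorem prec_antisymm {B : Set (ℤ × ℤ)} {x y : ℤ} (h1 : Prec B x y) (h2 : Prec B y x) :
    x = y := by
  unfold Prec at *
  rcases h1 with h1 | ⟨h1, h1'⟩ | ⟨h1, h1'⟩
  · exact h1
  · rcases h2 with h2 | ⟨h2, h2'⟩ | ⟨h2, h2'⟩
    · exact h2.symm
    · omega
    · exact absurd h2' h1'
  · rcases h2 with h2 | ⟨h2, h2'⟩ | ⟨h2, h2'⟩
    · exact h2.symm
    · exact absurd h1' h2'
    · omega

theorem prec_total (B : Set (ℤ × ℤ)) (x y : ℤ) : Prec B x y ∨ Prec B y x := by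
  unfold Prec
  rcases lt_trichotomy x y with h | h | h
  · by_cases h' : (x, y) ∈ B <;> simp [h, h']
  · exact Or.inl (Or.inl h)
  · by_cases h' : (y, x) ∈ B <;> simp [h, h']

theorem rankFn_mem {n : ℤ} (B : Set (ℤ × ℤ)) {x : ℤ} (hx : 1 ≤ x ∧ x ≤ n) :
    1 ≤ rankFn n B x ∧ rankFn n B x ≤ n := by
  classical
  unfold rankFn
  rw [if_pos hx]
  constructor
  · have : 0 < ((Finset.Icc 1 n).filter (fun y => Prec B y x)).card :=
      Finset.card_pos.2 ⟨x, Finset.mem_filter.2 ⟨Finset.mem_Icc.2 hx, Or.inl rfl⟩⟩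
    exact_mod_cast this
  · have := Finset.card_filter_le (Finset.Icc 1 n) (fun y => Prec B y x)
    rw [Int.card_Icc] at this
    omega

theorem rankFn_lt {n : ℤ} {B : Set (ℤ × ℤ)} (h : IsBiclosedFin n B) {x y : ℤ}
    (hx : 1 ≤ x ∧ x ≤ n) (hy : 1 ≤ y ∧ y ≤ n) (hxy : Prec B x y) (hne : x ≠ y) :
    rankFn n B x < rankFn n B y := by
  classical
  unfold rankFn
  rw [if_pos hx, if_pos hy]
  have : ((Finset.Icc 1 n).filter (fun z => Prec B z x)).card <
      ((Finset.Icc 1 n).filter (fun z => Prec B z y)).card := by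
    apply Finset.card_lt_card
    rw [Finset.ssubset_iff_of_subset]
    · refine ⟨y, Finset.mem_filter.2 ⟨Finset.mem_Icc.2 hy, Or.inl rfl⟩, ?_⟩
      intro hm
      exact hne (prec_antisymm hxy (Finset.mem_filter.1 hm).2)
    · intro z hz
      rw [Finset.mem_filter, Finset.mem_Icc] at *
      exact ⟨hz.1, prec_trans h hz.1 hx hy hz.2 hxy⟩
  exact_mod_cast this

theorem rankFn_out {n : ℤ} (B : Set (ℤ × ℤ)) {x : ℤ} (hx : ¬ (1 ≤ x ∧ x ≤ n)) :
    rankFn n B x = x := if_neg hx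

theorem rankFn_inj {n : ℤ} {B : Set (ℤ × ℤ)} (h : IsBiclosedFin n B) :
    Function.Injective (rankFn n B) := by
  intro x y hxy
  by_cases hx : 1 ≤ x ∧ x ≤ n
  · by_cases hy : 1 ≤ y ∧ y ≤ n
    · by_contra hne
      rcases prec_total B x y with h1 | h1
      · exact (rankFn_lt h hx hy h1 hne).ne hxy
      · exact (rankFn_lt h hy hx h1 (Ne.symm hne)).ne hxy.symm
    · have := rankFn_mem B hx
      rw [hxy, rankFn_out B hy] at this
      exact absurd this hy
  · by_cases hy : 1 ≤ y ∧ y ≤ n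
    · have := rankFn_mem B hy
      rw [← hxy, rankFn_out B hx] at this
      exact absurd this hx
    · rwa [rankFn_out B hx, rankFn_out B hy] at hxy

theorem rankFn_surj {n : ℤ} {B : Set (ℤ × ℤ)} (h : IsBiclosedFin n B) :
    Function.Surjective (rankFn n B) := by
  intro y
  by_cases hy : 1 ≤ y ∧ y ≤ n
  · have := Finset.surjOn_of_injOn_of_card_le (s := Finset.Icc 1 n) (t := Finset.Icc 1 n)
      (rankFn n B) (by
        intro x hx
        simp only [Finset.coe_Icc, Set.mem_Icc] at *
        exact rankFn_mem B hx) (rankFn_inj h).injOn le_rfl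
    obtain ⟨x, _, hx⟩ := this (show y ∈ (↑(Finset.Icc 1 n) : Set ℤ) by simpa using hy)
    exact ⟨x, hx⟩
  · exact ⟨y, rankFn_out B hy⟩

theorem symm_mem {n : ℤ} {σ : Equiv.Perm ℤ} (hσ : ∀ x : ℤ, (x < 1 ∨ n < x) → σ x = x)
    (x : ℤ) : (1 ≤ σ.symm x ∧ σ.symm x ≤ n) ↔ (1 ≤ x ∧ x ≤ n) := by
  constructor
  · intro h
    by_contra hx
    have := hσ x (by omega)
    have h2 : σ.symm x = x := by rw [Equiv.symm_apply_eq, this]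
    rw [h2] at h
    exact hx h
  · intro h
    by_contra hx
    have := hσ (σ.symm x) (by omega)
    rw [Equiv.apply_symm_apply] at this
    rw [← this] at hx
    exact hx h

theorem symm_eq_rankFn {n : ℤ} {B : Set (ℤ × ℤ)} {σ : Equiv.Perm ℤ}
    (hσ : ∀ x : ℤ, (x < 1 ∨ n < x) → σ x = x)
    (hB : B = {p : ℤ × ℤ | p ∈ Tn n ∧ σ.symm p.2 < σ.symm p.1}) (x : ℤ) :
    σ.symm x = rankFn n B x := by
  classical
  by_cases hx : 1 ≤ x ∧ x ≤ n
  · have key : ∀ y, 1 ≤ y ∧ y ≤ n → (Prec B y x ↔ σ.symm y ≤ σ.symm x) := by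
      intro y hy
      have hinj : σ.symm y = σ.symm x → y = x := fun h => σ.symm.injective h
      subst hB
      simp only [Prec, Tn, Set.mem_setOf_eq]
      rcases lt_trichotomy y x with h | h | h
      · have : σ.symm y ≠ σ.symm x := fun h' => by have := hinj h'; omega
        omega
      · simp [h]
      · have : σ.symm y ≠ σ.symm x := fun h' => by have := hinj h'; omega
        omega
    have him : ((Finset.Icc 1 n).filter (fun y => Prec B y x)).image σ.symm
        = Finset.Icc 1 (σ.symm x) := by
      ext z
      simp only [Finset.mem_image, Finset.mem_filter, Finset.mem_Icc]
      constructor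
      · rintro ⟨y, ⟨hy, hp⟩, rfl⟩
        exact ⟨((symm_mem hσ y).2 hy).1, (key y hy).1 hp⟩
      · rintro ⟨h1, h2⟩
        have h3 := ((symm_mem hσ x).2 hx).2
        have h4 : 1 ≤ σ z ∧ σ z ≤ n := by
          rw [← symm_mem hσ, Equiv.symm_apply_apply]
          omega
        exact ⟨σ z, ⟨h4, (key _ h4).2 (by rwa [Equiv.symm_apply_apply])⟩, by simp⟩
    have hcard := congrArg Finset.card him
    rw [Finset.card_image_of_injective _ σ.symm.injective, Int.card_Icc] at hcard
    have h1 := ((symm_mem hσ x).2 hx).1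
    unfold rankFn
    rw [if_pos hx, hcard]
    omega
  · rw [rankFn_out B hx, Equiv.symm_apply_eq]
    exact (hσ x (by omega)).symm

/-- A set `B ⊆ Tₙ` is biclosed if and only if it is the inversion set of a unique
permutation of `{1, …, n}` (modelled as a permutation of `ℤ` fixing everything
outside `[1, n]`). -/
theorem biclosedFin_iff_unique_inversionSet (n : ℤ) (hn : 1 ≤ n)
    (B : Set (ℤ × ℤ)) (hB : B ⊆ Tn n) :
    IsBiclosedFin n B ↔
      ∃! σ : Equiv.Perm ℤ, (∀ x : ℤ, (x < 1 ∨ n < x) → σ x = x) ∧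
        B = {p : ℤ × ℤ | p ∈ Tn n ∧ σ.symm p.2 < σ.symm p.1} := by
  constructor
  · intro h
    let e : Equiv.Perm ℤ := Equiv.ofBijective (rankFn n B) ⟨rankFn_inj h, rankFn_surj h⟩
    have he : ∀ x, e x = rankFn n B x := fun x => rfl
    refine ⟨e.symm, ⟨?_, ?_⟩, ?_⟩
    · intro x hx
      rw [Equiv.symm_apply_eq, he, rankFn_out B (by omega)]
    · ext ⟨i, j⟩
      simp only [Set.mem_setOf_eq, Equiv.symm_symm, he]
      constructor
      · intro hm
        have ht := hB hm
        obtain ⟨h1, h2, h3⟩ := id ht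
        simp only at h1 h2 h3
        exact ⟨ht, rankFn_lt h (by omega) (by omega) (Or.inr (Or.inr ⟨h2, hm⟩)) (by omega)⟩
      · rintro ⟨⟨h1, h2, h3⟩, h4⟩
        simp only at h1 h2 h3
        by_contra hm
        have := rankFn_lt h (x := i) (y := j) (by omega) (by omega)
          (Or.inr (Or.inl ⟨h2, hm⟩)) (by omega)
        omega
    · rintro τ ⟨h1, h2⟩
      have : τ.symm = e := Equiv.ext fun x => by rw [he, symm_eq_rankFn h1 h2]
      rw [← this, Equiv.symm_symm]
  · rintro ⟨σ, ⟨_, h2⟩, _⟩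
    subst h2
    refine ⟨⟨hB, ?_⟩, hB, Set.diff_subset, ?_⟩
    · rintro i j k hij hjk ⟨⟨a1, a2, a3⟩, a4⟩ ⟨⟨b1, b2, b3⟩, b4⟩
      simp only [Tn, Set.mem_setOf_eq] at *
      omega
    · rintro i j k hij hjk ⟨⟨a1, a2, a3⟩, a4⟩ ⟨⟨b1, b2, b3⟩, b4⟩
      simp only [Tn, Set.mem_setOf_eq, Set.mem_diff] at *
      omega
end

section
/- A translation-invariant set B ⊆ T̃ is finite and biclosed if and only if there exists f ∈ S̃ₙ such that B = I(f); moreover, such an f is unique. -/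
/-- `T̃ = {(i,j) ∈ ℤ × ℤ : i < j and n ∤ (j - i)}`. -/
def Ttil (n : ℤ) : Set (ℤ × ℤ) := {p | p.1 < p.2 ∧ ¬ (n ∣ (p.2 - p.1))}

/-- `B` is translation-invariant: `(i,j) ∈ B ↔ (i+n, j+n) ∈ B`. -/
def TransInv (n : ℤ) (B : Set (ℤ × ℤ)) : Prop :=
  ∀ i j : ℤ, (i, j) ∈ B ↔ (i + n, j + n) ∈ B

/-- A translation-invariant subset `B ⊆ T̃` is closed if it satisfies the
three closure conditions of affine type A. -/
def IsClosedT (n : ℤ) (B : Set (ℤ × ℤ)) : Prop :=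
  B ⊆ Ttil n ∧
  (∀ i j k : ℤ, i < j → j < k → ¬ (n ∣ (k - i)) →
    (i, j) ∈ B → (j, k) ∈ B → (i, k) ∈ B) ∧
  (∀ i j k : ℤ, i < j → j < k → (n ∣ (k - i)) →
    (i, j) ∈ B → (j, k) ∈ B →
    ∀ l : ℤ, 0 ≤ l → (i, j + l * n) ∈ B ∧ (j, k + l * n) ∈ B) ∧
  (∀ i j k : ℤ, i < j → j < k → (n ∣ (k - j)) →
    (i, j) ∈ B → (i, k) ∈ B →
    ∀ l : ℤ, 0 ≤ l → j + l * n ≤ k → (i, j + l * n) ∈ B)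

/-- `B` is coclosed if `T̃ \ B` is closed. -/
def IsCoclosedT (n : ℤ) (B : Set (ℤ × ℤ)) : Prop :=
  IsClosedT n (Ttil n \ B)

/-- `B` is biclosed if it is both closed and coclosed. -/
def IsBiclosedT (n : ℤ) (B : Set (ℤ × ℤ)) : Prop :=
  IsClosedT n B ∧ IsCoclosedT n B

namespace AffB

lemma per_mul {α : Type*} {n : ℤ} {φ : ℤ → α} (h : ∀ i, φ (i + n) = φ i) (c i : ℤ) :
    φ (i + c * n) = φ i := by
  have := (show Function.Periodic φ n from h).int_mul c i
  simpa using this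

lemma perm_mul {n : ℤ} {f : ℤ → ℤ} (h : ∀ i, f (i + n) = f i + n) (c i : ℤ) :
    f (i + c * n) = f i + c * n := by
  have := per_mul (n := n) (φ := fun i => f i - i) (by intro i; simp only [h]; ring) c i
  linarith

/-- representative in `1..n` -/
def rep (n x : ℤ) : ℤ := (x - 1) % n + 1

lemma rep_mem {n : ℤ} (hn : 1 ≤ n) (x : ℤ) : rep n x ∈ Finset.Icc (1 : ℤ) n := by
  have h1 := Int.emod_nonneg (x - 1) (show n ≠ 0 by omega)
  have h2 := Int.emod_lt_of_pos (x - 1) (show 0 < n by omega)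
  simp only [rep, Finset.mem_Icc]
  omega

lemma rep_eq (n x : ℤ) : x = rep n x + ((x - 1) / n) * n := by
  have := Int.emod_add_mul_ediv (x - 1) n
  simp only [rep]
  linarith

lemma eq_of_dvd {n a b : ℤ} (ha : a ∈ Finset.Icc (1 : ℤ) n) (hb : b ∈ Finset.Icc (1 : ℤ) n)
    (h : n ∣ a - b) : a = b := by
  simp only [Finset.mem_Icc] at ha hb
  have := Int.eq_zero_of_abs_lt_dvd h (by rw [abs_lt]; constructor <;> omega)
  omega

lemma rep_injOn {n : ℤ} {σ : ℤ → ℤ}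
    (hσ : ∀ a b, n ∣ σ a - σ b → n ∣ a - b) :
    Set.InjOn (fun k => rep n (σ k)) (Finset.Icc (1 : ℤ) n) := by
  intro a ha b hb hab
  simp only at hab
  refine eq_of_dvd ha hb (hσ a b ?_)
  rw [rep_eq n (σ a), rep_eq n (σ b), hab]
  exact ⟨(σ a - 1) / n - (σ b - 1) / n, by ring⟩

lemma rep_surjOn {n : ℤ} (hn : 1 ≤ n) {σ : ℤ → ℤ}
    (hσ : ∀ a b, n ∣ σ a - σ b → n ∣ a - b) :
    Set.SurjOn (fun k => rep n (σ k)) (Finset.Icc (1 : ℤ) n) (Finset.Icc (1 : ℤ) n) :=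
  Finset.surjOn_of_injOn_of_card_le _ (fun k _ => rep_mem hn _) (rep_injOn hσ) le_rfl

lemma sum_perm {n : ℤ} (hn : 1 ≤ n) {σ φ : ℤ → ℤ}
    (hσ : ∀ a b, n ∣ σ a - σ b → n ∣ a - b) (hφ : ∀ i, φ (i + n) = φ i) :
    ∑ k ∈ Finset.Icc (1 : ℤ) n, φ (σ k) = ∑ k ∈ Finset.Icc (1 : ℤ) n, φ k := by
  refine Finset.sum_nbij (fun k => rep n (σ k)) (fun k _ => rep_mem hn _) (rep_injOn hσ)
    (rep_surjOn hn hσ) ?_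
  intro k _
  conv_lhs => rw [rep_eq n (σ k)]
  exact per_mul hφ _ _

lemma symm_per {n : ℤ} {f : Equiv.Perm ℤ} (h : ∀ i, f (i + n) = f i + n) (i : ℤ) :
    f.symm (i + n) = f.symm i + n := by
  rw [Equiv.symm_apply_eq, h, Equiv.apply_symm_apply]

/-- disp bound -/
lemma disp_bound {n : ℤ} (hn : 1 ≤ n) {g : ℤ → ℤ} (h : ∀ i, g (i + n) = g i + n) :
    ∃ C : ℤ, ∀ i, |g i - i| ≤ C := by
  refine ⟨∑ k ∈ Finset.Icc (1 : ℤ) n, |g k - k|, fun i => ?_⟩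
  have h1 : g i - i = g (rep n i) - rep n i := by
    conv_lhs => rw [rep_eq n i]
    rw [perm_mul h]; ring
  rw [h1]
  exact Finset.single_le_sum (f := fun k => |g k - k|) (fun _ _ => abs_nonneg _) (rep_mem hn i)

lemma back {n : ℤ} (hn : 1 ≤ n) {g : ℤ → ℤ} (hinj : Function.Injective g)
    (h : ∀ i, g (i + n) = g i + n) :
    IsBiclosedT n {p : ℤ × ℤ | p ∈ Ttil n ∧ g p.2 < g p.1} ∧
    {p ∈ {p : ℤ × ℤ | p ∈ Ttil n ∧ g p.2 < g p.1} | 0 ≤ p.1 ∧ p.1 < n}.Finite := by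
  have hm := perm_mul h
  have dv : ∀ l : ℤ, 0 ≤ l → 0 ≤ l * n := fun l hl => mul_nonneg hl (by omega)
  have dd : ∀ a b l : ℤ, n ∣ (a + l * n) - b → n ∣ a - b := by
    intro a b l ⟨c, hc⟩
    exact ⟨c - l, by linarith⟩
  refine ⟨⟨⟨fun p hp => hp.1, ?_, ?_, ?_⟩, ⟨fun p hp => hp.1, ?_, ?_, ?_⟩⟩, ?_⟩
  · rintro i j k hij hjk hnd ⟨_, h1⟩ ⟨_, h2⟩
    exact ⟨⟨by simp only; omega, hnd⟩, by simp only at *; omega⟩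
  · rintro i j k hij hjk ⟨c, hc⟩ ⟨_, h1⟩ ⟨_, h2⟩
    exfalso
    have : k = i + c * n := by linarith
    have h3 := hm c i
    rw [← this] at h3
    simp only at *
    linarith
  · rintro i j k hij hjk ⟨c, hc⟩ ⟨t1, h1⟩ ⟨t2, h2⟩ l hl hlk
    have e : k = j + c * n := by linarith
    have h3 := hm c j
    have h4 := hm l j
    rw [← e] at h3
    have := dv l hl
    refine ⟨⟨by simp only; omega, fun hd => t1.2 (dd _ _ _ hd)⟩, ?_⟩
    simp only at *
    linarith
  · rintro i j k hij hjk hnd ⟨t1, h1⟩ ⟨t2, h2⟩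
    have t : (i, k) ∈ Ttil n := ⟨by simp only; omega, hnd⟩
    refine ⟨t, fun h3 => ?_⟩
    have h3 := h3.2
    have h1 : ¬ g j < g i := fun h => h1 ⟨t1, h⟩
    have h2 : ¬ g k < g j := fun h => h2 ⟨t2, h⟩
    simp only at *
    omega
  · rintro i j k hij hjk hd ⟨t1, h1⟩ ⟨t2, h2⟩ l hl
    have h1 : ¬ g j < g i := fun h => h1 ⟨t1, h⟩
    have h2 : ¬ g k < g j := fun h => h2 ⟨t2, h⟩
    have := dv l hl
    refine ⟨⟨⟨by simp only; omega, fun hd => t1.2 (dd _ _ _ hd)⟩, fun h3 => ?_⟩,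
      ⟨⟨by simp only; omega, fun hd => t2.2 (dd _ _ _ hd)⟩, fun h3 => ?_⟩⟩
    · have := h3.2; simp only [hm] at this; omega
    · have := h3.2; simp only [hm] at this; omega
  · rintro i j k hij hjk hd ⟨t1, h1⟩ ⟨t2, h2⟩ l hl hlk
    have h1 : ¬ g j < g i := fun h => h1 ⟨t1, h⟩
    have := dv l hl
    refine ⟨⟨by simp only; omega, fun hd => t1.2 (dd _ _ _ hd)⟩, fun h3 => ?_⟩
    have := h3.2; simp only [hm] at this; omega
  · obtain ⟨C, hC⟩ := disp_bound hn h
    refine ((Finset.Icc 0 n ×ˢ Finset.Icc 0 (n + 2 * C) : Finset (ℤ × ℤ)).finite_toSet).subset ?_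
    rintro ⟨i, j⟩ ⟨⟨⟨t1, _⟩, t2⟩, h1, h2⟩
    have e1 := abs_le.1 (hC i)
    have e2 := abs_le.1 (hC j)
    simp only [Finset.coe_product, Finset.coe_Icc, Set.mem_prod, Set.mem_Icc] at *
    omega

/-- uniqueness -/
lemma uniq {n : ℤ} (hn : 1 ≤ n) {f₁ f₂ : Equiv.Perm ℤ}
    (p₁ : ∀ i, f₁ (i + n) = f₁ i + n) (p₂ : ∀ i, f₂ (i + n) = f₂ i + n)
    (s₁ : (∑ k ∈ Finset.Icc (1 : ℤ) n, (f₁ k - k)) = 0)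
    (s₂ : (∑ k ∈ Finset.Icc (1 : ℤ) n, (f₂ k - k)) = 0)
    (hB : {p : ℤ × ℤ | p ∈ Ttil n ∧ f₁.symm p.2 < f₁.symm p.1} =
      {p : ℤ × ℤ | p ∈ Ttil n ∧ f₂.symm p.2 < f₂.symm p.1}) : f₁ = f₂ := by
  have key : ∀ i j, i < j → (f₁.symm j < f₁.symm i ↔ f₂.symm j < f₂.symm i) := by
    intro i j hij
    by_cases hd : n ∣ j - i
    · obtain ⟨c, hc⟩ := hd
      have e : j = i + c * n := by linarith
      have e1 := perm_mul (symm_per p₁) c i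
      have e2 := perm_mul (symm_per p₂) c i
      rw [← e] at e1 e2
      constructor <;> intro <;> linarith
    · have := Set.ext_iff.1 hB (i, j)
      have t : (i, j) ∈ Ttil n := ⟨hij, hd⟩
      simpa [t] using this
  have inj₁ := f₁.symm.injective
  have inj₂ := f₂.symm.injective
  have key2 : ∀ i j, f₂.symm i < f₂.symm j → f₁.symm i < f₁.symm j := by
    intro i j h
    rcases lt_trichotomy i j with hij | hij | hij
    · have := key i j hij
      have ne : f₁.symm i ≠ f₁.symm j := fun h => by have := inj₁ h; omega
      omega
    · subst hij; omega
    · exact (key j i hij).2 h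
  have mono : ∀ a b, a < b → f₁.symm (f₂ a) < f₁.symm (f₂ b) := by
    intro a b hab
    apply key2
    simpa using hab
  have step : ∀ k, f₁.symm (f₂ (k + 1)) = f₁.symm (f₂ k) + 1 := by
    intro k
    have h1 := mono k (k + 1) (by omega)
    obtain ⟨m, hm⟩ : ∃ m, f₁.symm (f₂ m) = f₁.symm (f₂ k) + 1 :=
      ⟨f₂.symm (f₁ (f₁.symm (f₂ k) + 1)), by simp⟩
    have h2 : k < m := by
      by_contra hle
      rcases (not_lt.1 hle).lt_or_eq with h | h
      · have := mono m k h; omega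
      · subst h; omega
    rcases (show k + 1 ≤ m by omega).lt_or_eq with h | h
    · have := mono _ _ h; omega
    · rw [h, hm]
  obtain ⟨c, hc⟩ : ∃ c, ∀ k, f₁.symm (f₂ k) = k + c := by
    refine ⟨f₁.symm (f₂ 0), fun k => ?_⟩
    have := perm_mul (n := 1) (f := fun k => f₁.symm (f₂ k)) step k 0
    simp only [zero_add, mul_one] at this
    rw [this]; ring
  have hf : ∀ k, f₂ k = f₁ (k + c) := by
    intro k
    rw [← hc]; simp
  have hs := sum_perm hn (σ := fun k => k + c) (φ := fun k => f₁ k - k)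
    (by intro a b h; simpa using h) (by intro i; simp only [p₁]; ring)
  rw [s₁] at hs
  have : ∑ k ∈ Finset.Icc (1 : ℤ) n, (f₂ k - k)
      = ∑ k ∈ Finset.Icc (1 : ℤ) n, (f₁ (k + c) - (k + c)) + ∑ k ∈ Finset.Icc (1 : ℤ) n, c := by
    rw [← Finset.sum_add_distrib]
    refine Finset.sum_congr rfl fun k _ => ?_
    rw [hf]; ring
  rw [hs, s₂, Finset.sum_const, Int.card_Icc] at this
  have h0 : c = 0 := by
    simp only [nsmul_eq_mul, zero_add] at this
    rcases mul_eq_zero.1 this.symm with h | h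
    · push_cast at h; omega
    · exact h
  ext k
  rw [hf, h0, add_zero]

/-- the order relation -/
def R (B : Set (ℤ × ℤ)) (a b : ℤ) : Prop := (a < b ∧ (a, b) ∉ B) ∨ (b < a ∧ (b, a) ∈ B)

lemma trans_mul {n : ℤ} {B : Set (ℤ × ℤ)} (h : TransInv n B) (c i j : ℤ) :
    (i + c * n, j + c * n) ∈ B ↔ (i, j) ∈ B := by
  have := per_mul (n := n) (φ := fun x => (i + x, j + x) ∈ B)
    (by intro x; simp only [← add_assoc]; exact propext (h _ _).symm) c 0
  simpa using this

lemma exists_M {n : ℤ} (hn : 1 ≤ n) {B : Set (ℤ × ℤ)} (h : TransInv n B)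
    (hfin : {p ∈ B | 0 ≤ p.1 ∧ p.1 < n}.Finite) :
    ∃ M : ℕ, ∀ i j, (i, j) ∈ B → j - i ≤ M := by
  obtain ⟨C, hC⟩ := (hfin.image (fun p : ℤ × ℤ => p.2 - p.1)).bddAbove
  refine ⟨C.toNat, fun i j hij => ?_⟩
  have h1 := Int.emod_nonneg i (show n ≠ 0 by omega)
  have h2 := Int.emod_lt_of_pos i (show 0 < n by omega)
  have h3 := Int.emod_add_mul_ediv i n
  have h4 := (trans_mul h (-(i / n)) i j).2 hij
  have h5 : i + -(i / n) * n = i % n := by linarith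
  have := hC ⟨_, ⟨h4, by simp only [h5]; exact h1, by simp only [h5]; exact h2⟩, rfl⟩
  simp only at this
  omega

lemma up {n : ℤ} (hn : 1 ≤ n) {B : Set (ℤ × ℤ)} (hBt : TransInv n B)
    (hb : IsBiclosedT n B) {M : ℕ} (hM : ∀ i j, (i, j) ∈ B → j - i ≤ M)
    {i j : ℤ} (hij : i < j) (hnot : (i, j) ∉ B) (m : ℤ) (hm : 0 ≤ m) :
    (i, j + m * n) ∉ B := by
  intro hin
  have hT := hb.1.1 hin
  have hmn : m ≤ m * n := by nlinarith
  have hd : ∀ l : ℤ, ¬ n ∣ (j + l * n) - i := by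
    rintro l ⟨c, hc⟩
    exact hT.2 ⟨c - l + m, by simp only; linarith⟩
  have hd0 : ¬ n ∣ j - i := by simpa using hd 0
  set L : ℤ := m + M + 1 with hL
  have hLn : L ≤ L * n := by nlinarith
  have h1 : (i, j + L * n) ∉ B := fun h => by have := hM _ _ h; omega
  have := hb.2.2.2.2 i j (j + L * n) hij (by omega) ⟨L, by ring⟩ ⟨⟨hij, hd0⟩, hnot⟩
    ⟨⟨by simp only; omega, hd L⟩, h1⟩ m hm (by nlinarith)
  exact this.2 hin

lemma cyc1 {n : ℤ} (hn : 1 ≤ n) {B : Set (ℤ × ℤ)} (hBt : TransInv n B)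
    (hb : IsBiclosedT n B) {M : ℕ} (hM : ∀ i j, (i, j) ∈ B → j - i ≤ M)
    {a b c : ℤ} (hab : a < b) (hbc : b < c) (h1 : (a, b) ∉ B) (h2 : (b, c) ∉ B) :
    (a, c) ∉ B := by
  intro h3
  have hT := hb.1.1 h3
  by_cases d1 : n ∣ b - a
  · obtain ⟨m, hm⟩ := d1
    have hm0 : 0 ≤ m := by by_contra hh; nlinarith
    apply up hn hBt hb hM hbc h2 m hm0
    have := (trans_mul hBt m a c).2 h3
    rwa [show a + m * n = b by linarith] at this
  by_cases d2 : n ∣ c - b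
  · obtain ⟨m, hm⟩ := d2
    have hm0 : 0 ≤ m := by by_contra hh; nlinarith
    apply up hn hBt hb hM hab h1 m hm0
    rwa [show b + m * n = c by linarith]
  exact (hb.2.2.1 a b c hab hbc hT.2 ⟨⟨hab, d1⟩, h1⟩ ⟨⟨hbc, d2⟩, h2⟩).2 h3

lemma cyc2 {n : ℤ} (hn : 1 ≤ n) {B : Set (ℤ × ℤ)} (hBt : TransInv n B)
    (hb : IsBiclosedT n B) {M : ℕ} (hM : ∀ i j, (i, j) ∈ B → j - i ≤ M)
    {a b c : ℤ} (hab : a < b) (hbc : b < c) (h1 : (a, b) ∈ B) (h2 : (b, c) ∈ B) :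
    (a, c) ∈ B := by
  by_cases d : n ∣ c - a
  · exfalso
    have := (hb.1.2.2.1 a b c hab hbc d h1 h2 (M + 1) (by omega)).1
    have := hM _ _ this
    nlinarith
  · exact hb.1.2.1 a b c hab hbc d h1 h2

lemma R_trans {n : ℤ} (hn : 1 ≤ n) {B : Set (ℤ × ℤ)} (hBt : TransInv n B)
    (hb : IsBiclosedT n B) {M : ℕ} (hM : ∀ i j, (i, j) ∈ B → j - i ≤ M)
    {a b c : ℤ} (h1 : R B a b) (h2 : R B b c) : R B a c := by
  have C1 := @cyc1 n hn B hBt hb M hM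
  have C2 := @cyc2 n hn B hBt hb M hM
  rcases h1 with ⟨o1, h1⟩ | ⟨o1, h1⟩ <;> rcases h2 with ⟨o2, h2⟩ | ⟨o2, h2⟩
  · exact Or.inl ⟨o1.trans o2, C1 o1 o2 h1 h2⟩
  · rcases lt_trichotomy a c with h | h | h
    · exact Or.inl ⟨h, fun h3 => h1 (C2 h o2 h3 h2)⟩
    · subst h; exact absurd h2 h1
    · exact Or.inr ⟨h, by_contra fun h3 => C1 h o1 h3 h1 h2⟩
  · rcases lt_trichotomy a c with h | h | h
    · exact Or.inl ⟨h, fun h3 => h2 (C2 o1 h h1 h3)⟩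
    · subst h; exact absurd h1 h2
    · exact Or.inr ⟨h, by_contra fun h3 => C1 o2 h h2 h3 h1⟩
  · exact Or.inr ⟨o2.trans o1, C2 o2 o1 h2 h1⟩

open Classical in
/-- indicator of the order -/
noncomputable def psi (B : Set (ℤ × ℤ)) (a b : ℤ) : ℤ := if R B a b then 1 else 0

lemma psi_anti {B : Set (ℤ × ℤ)} {a b : ℤ} (h : a ≠ b) : psi B a b = 1 - psi B b a := by
  have : R B a b ↔ ¬ R B b a := by
    unfold R
    rcases lt_or_gt_of_ne h with h | h
    · have := h.not_gt; tauto
    · have := h.not_gt; tauto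
  unfold psi
  by_cases h : R B b a <;> simp [this, h]

lemma psi_self (B : Set (ℤ × ℤ)) (a : ℤ) : psi B a a = 0 := by
  simp [psi, R]

lemma psi_per {n : ℤ} {B : Set (ℤ × ℤ)} (hBt : TransInv n B) (a b : ℤ) :
    psi B (a + n) (b + n) = psi B a b := by
  have : R B (a + n) (b + n) ↔ R B a b := by
    unfold R
    rw [← hBt a b, ← hBt b a]
    simp
  unfold psi
  by_cases h : R B a b <;> simp [this, h]

/-- the position function -/
noncomputable def pos (B : Set (ℤ × ℤ)) (M : ℕ) (j : ℤ) : ℤ :=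
  j + ∑ d ∈ Finset.range M, (psi B (j + (d + 1)) j + psi B (j - (d + 1)) j - 1)

lemma sum_split (φ : ℤ → ℤ) {a b c : ℤ} (h1 : a ≤ b) (h2 : b ≤ c) :
    ∑ k ∈ Finset.Ico a b, φ k + ∑ k ∈ Finset.Ico b c, φ k = ∑ k ∈ Finset.Ico a c, φ k := by
  rw [← Finset.Ico_union_Ico_eq_Ico h1 h2,
    Finset.sum_union (Finset.Ico_disjoint_Ico_consecutive a b c)]

lemma pos_eq (B : Set (ℤ × ℤ)) (M : ℕ) (j : ℤ) :
    pos B M j = j - M + ∑ k ∈ Finset.Ico (j - M) (j + M + 1), psi B k j := by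
  unfold pos
  induction M with
  | zero =>
    have e : Finset.Ico j (j + 1) = {j} := by
      ext x; simp only [Finset.mem_Ico, Finset.mem_singleton]; omega
    simp [e, psi_self]
  | succ m ih =>
    rw [Finset.sum_range_succ, ← add_assoc, ih]
    push_cast
    rw [← sum_split _ (show j - (m + 1) ≤ j - m by omega)
      (show j - m ≤ j + (m + 1) + 1 by omega),
      ← sum_split _ (show j - m ≤ j + m + 1 by omega)
      (show j + m + 1 ≤ j + (m + 1) + 1 by omega)]
    have e1 : Finset.Ico (j - ((m : ℤ) + 1)) (j - m) = {j - ((m : ℤ) + 1)} := by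
      ext x; simp only [Finset.mem_Ico, Finset.mem_singleton]; omega
    have e2 : Finset.Ico (j + (m : ℤ) + 1) (j + (m + 1) + 1) = {j + ((m : ℤ) + 1)} := by
      ext x; simp only [Finset.mem_Ico, Finset.mem_singleton]; omega
    rw [e1, e2, Finset.sum_singleton, Finset.sum_singleton]
    ring

lemma pos_window {B : Set (ℤ × ℤ)} {M : ℕ} (hM : ∀ i j, (i, j) ∈ B → j - i ≤ M)
    {x y j : ℤ} (hx : x ≤ j - M) (hy : j + M + 1 ≤ y) :
    pos B M j = x + ∑ k ∈ Finset.Ico x y, psi B k j := by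
  rw [pos_eq, ← sum_split _ hx (show j - M ≤ y by omega),
    ← sum_split _ (show j - M ≤ j + M + 1 by omega) hy]
  have e1 : ∑ k ∈ Finset.Ico x (j - M), psi B k j = j - M - x := by
    rw [Finset.sum_congr rfl (g := fun _ => (1 : ℤ))]
    · simp; omega
    · intro k hk
      rw [Finset.mem_Ico] at hk
      have : R B k j := Or.inl ⟨by omega, fun h => by have := hM _ _ h; omega⟩
      simp [psi, this]
  have e2 : ∑ k ∈ Finset.Ico (j + M + 1) y, psi B k j = 0 := by
    apply Finset.sum_eq_zero
    intro k hk
    rw [Finset.mem_Ico] at hk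
    have : ¬ R B k j := by
      rintro (h | h)
      · omega
      · have := hM _ _ h.2; omega
    simp [psi, this]
  rw [e1, e2]; ring

lemma pos_mono {n : ℤ} (hn : 1 ≤ n) {B : Set (ℤ × ℤ)} (hBt : TransInv n B) (hb : IsBiclosedT n B)
    {M : ℕ} (hM : ∀ i j, (i, j) ∈ B → j - i ≤ M) {i j : ℤ} (h : R B i j) :
    pos B M i < pos B M j := by
  rw [pos_window hM (x := min i j - M) (y := max i j + M + 1) (by omega) (by omega),
    pos_window hM (j := j) (x := min i j - M) (y := max i j + M + 1) (by omega) (by omega)]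
  apply add_lt_add_right
  apply Finset.sum_lt_sum
  · intro k _
    by_cases hk : R B k i
    · simp [psi, hk, R_trans hn hBt hb hM hk h]
    · simp only [psi, hk, if_false]; split_ifs <;> simp
  · refine ⟨i, by rw [Finset.mem_Ico]; omega, ?_⟩
    rw [psi_self]; simp [psi, h]

lemma pos_per {n : ℤ} {B : Set (ℤ × ℤ)} (hBt : TransInv n B) (M : ℕ) (i : ℤ) :
    pos B M (i + n) = pos B M i + n := by
  unfold pos
  have : ∀ d : ℕ, psi B (i + n + (d + 1)) (i + n) + psi B (i + n - (d + 1)) (i + n) - 1 =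
      psi B (i + (d + 1)) i + psi B (i - (d + 1)) i - 1 := by
    intro d
    rw [← psi_per hBt (i + (d + 1)) i, ← psi_per hBt (i - (d + 1)) i]
    ring_nf
  simp only [this]
  ring

lemma pos_sum {n : ℤ} (hn : 1 ≤ n) {B : Set (ℤ × ℤ)} (hBt : TransInv n B) (M : ℕ) :
    ∑ k ∈ Finset.Icc (1 : ℤ) n, (pos B M k - k) = 0 := by
  simp only [pos, add_sub_cancel_left]
  rw [Finset.sum_comm]
  apply Finset.sum_eq_zero
  intro d _
  have h := sum_perm hn (σ := fun k => k - (d + 1)) (φ := fun k => psi B (k + (d + 1)) k)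
    (by intro a b h; simpa using h)
    (by intro i; rw [← psi_per hBt (i + (d + 1)) i]; ring_nf)
  simp only [sub_add_cancel] at h
  have : ∀ k : ℤ, psi B (k + (d + 1)) k + psi B (k - (d + 1)) k - 1 =
      psi B (k + (d + 1)) k - psi B k (k - (d + 1)) := by
    intro k
    rw [psi_anti (a := k - (d + 1)) (b := k) (by omega)]; ring
  simp only [this, Finset.sum_sub_distrib]
  rw [h]; ring

lemma forward {n : ℤ} (hn : 1 ≤ n) {B : Set (ℤ × ℤ)} (hBt : TransInv n B)
    (hb : IsBiclosedT n B) (hfin : {p ∈ B | 0 ≤ p.1 ∧ p.1 < n}.Finite) :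
    ∃ f : Equiv.Perm ℤ,
        (∀ i : ℤ, f (i + n) = f i + n) ∧
        (∑ k ∈ Finset.Icc (1 : ℤ) n, (f k - k)) = 0 ∧
        B = {p : ℤ × ℤ | p ∈ Ttil n ∧ f.symm p.2 < f.symm p.1} := by
  obtain ⟨M, hM⟩ := exists_M hn hBt hfin
  have hmono := @pos_mono n hn B hBt hb M hM
  have hper := pos_per hBt M
  have hlt : ∀ i j, i < j → (pos B M j < pos B M i ↔ (i, j) ∈ B) := by
    intro i j hij
    by_cases h : (i, j) ∈ B
    · have := hmono (i := j) (j := i) (Or.inr ⟨hij, h⟩)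
      simp [h, this]
    · have := hmono (i := i) (j := j) (Or.inl ⟨hij, h⟩)
      simp only [h, iff_false]; omega
  have hne : ∀ i j, i < j → pos B M i ≠ pos B M j := by
    intro i j hij
    by_cases h : (i, j) ∈ B
    · exact (hmono (i := j) (j := i) (Or.inr ⟨hij, h⟩)).ne'
    · exact (hmono (i := i) (j := j) (Or.inl ⟨hij, h⟩)).ne
  have hinj : Function.Injective (pos B M) := by
    intro i j hij
    rcases lt_trichotomy i j with h | h | h
    · exact absurd hij (hne _ _ h)
    · exact h
    · exact absurd hij.symm (hne _ _ h)
  have hmod : ∀ a b, n ∣ pos B M a - pos B M b → n ∣ a - b := by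
    rintro a b ⟨c, hc⟩
    have : a = b + c * n := hinj (by rw [perm_mul hper]; linarith)
    exact ⟨c, by rw [this]; ring⟩
  have hsurj : Function.Surjective (pos B M) := by
    intro m
    obtain ⟨k, _, hk⟩ := rep_surjOn hn hmod (rep_mem hn m)
    simp only at hk
    have e1 := rep_eq n m
    have e2 := rep_eq n (pos B M k)
    refine ⟨k + ((m - 1) / n - (pos B M k - 1) / n) * n, ?_⟩
    rw [perm_mul hper, sub_mul]
    linarith
  set g : Equiv.Perm ℤ := Equiv.ofBijective _ ⟨hinj, hsurj⟩ with hg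
  have hgp : ∀ i, g i = pos B M i := fun i => rfl
  have hperg : ∀ i, g (i + n) = g i + n := hper
  refine ⟨g.symm, symm_per hperg, ?_, ?_⟩
  · have h := sum_perm hn (σ := fun k => g k) (φ := fun k => g.symm k - k) hmod
      (by intro i; simp only [symm_per hperg]; ring)
    rw [← h]
    simp only [Equiv.symm_apply_apply]
    have h0 := pos_sum hn hBt M
    simp only [hgp]
    rw [← neg_eq_zero, ← Finset.sum_neg_distrib]
    simpa using h0
  · ext ⟨i, j⟩
    simp only [Equiv.symm_symm, Set.mem_setOf_eq, hgp]
    constructor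
    · intro h
      have hT := hb.1.1 h
      exact ⟨hT, (hlt _ _ hT.1).2 h⟩
    · rintro ⟨hT, h⟩
      exact (hlt _ _ hT.1).1 h

end AffB

/-- A translation-invariant set `B ⊆ T̃` is finite and biclosed if and only if it
is the inversion set of a unique element of the affine symmetric group `S̃ₙ`. -/
theorem finite_biclosed_iff_unique_affinePerm (n : ℤ) (hn : 1 ≤ n)
    (B : Set (ℤ × ℤ)) (hB : B ⊆ Ttil n) (hBt : TransInv n B) :
    (IsBiclosedT n B ∧ {p ∈ B | 0 ≤ p.1 ∧ p.1 < n}.Finite) ↔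
      ∃! f : Equiv.Perm ℤ,
        (∀ i : ℤ, f (i + n) = f i + n) ∧
        (∑ k ∈ Finset.Icc (1 : ℤ) n, (f k - k)) = 0 ∧
        B = {p : ℤ × ℤ | p ∈ Ttil n ∧ f.symm p.2 < f.symm p.1} := by
  constructor
  · rintro ⟨hb, hfin⟩
    obtain ⟨f, h1, h2, h3⟩ := AffB.forward hn hBt hb hfin
    refine ⟨f, ⟨h1, h2, h3⟩, ?_⟩
    rintro f' ⟨h1', h2', h3'⟩
    exact AffB.uniq hn h1' h1 h2' h2 (h3'.symm.trans h3)
  · rintro ⟨f, ⟨h1, _, h3⟩, _⟩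
    rw [h3]
    exact AffB.back hn f.symm.injective (AffB.symm_per h1)
end

section
/- For every translationally invariant total order ≺ on ℤ, the inversion set I(≺) = {(i,j) ∈ T̃ : j ≺ i} is a translation-invariant biclosed subset of T̃. -/
theorem shift_nat (n : ℤ) (r : ℤ → ℤ → Prop)
    (hrt : ∀ i j : ℤ, r i j ↔ r (i + n) (j + n)) (l : ℕ) :
    ∀ i j : ℤ, r i j ↔ r (i + l * n) (j + l * n) := by
  induction l with
  | zero => intro i j; simp
  | succ l ih =>
    intro i j
    rw [ih, hrt]
    have e : ∀ x : ℤ, x + l * n + n = x + ((l + 1 : ℕ) : ℤ) * n := by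
      intro x; push_cast; ring
    rw [e, e]

theorem chain_pos (n : ℤ) (r : ℤ → ℤ → Prop) (htr : ∀ a b c, r a b → r b c → r a c)
    (hrt : ∀ i j : ℤ, r i j ↔ r (i + n) (j + n)) (x : ℤ) (h : r x (x + n)) (l : ℕ) :
    r x (x + ((l : ℤ) + 1) * n) := by
  induction l with
  | zero => simpa using h
  | succ l ih =>
    have h2 := (hrt _ _).1 ih
    have e : x + ((l : ℤ) + 1) * n + n = x + (((l + 1 : ℕ) : ℤ) + 1) * n := by
      push_cast; ring
    rw [e] at h2
    exact htr _ _ _ h h2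

theorem chain_int (n : ℤ) (r : ℤ → ℤ → Prop) (htr : ∀ a b c, r a b → r b c → r a c)
    (hrt : ∀ i j : ℤ, r i j ↔ r (i + n) (j + n)) (x : ℤ) (h : r x (x + n)) (l m : ℤ)
    (hl : 0 ≤ l) (hlm : l < m) :
    r (x + l * n) (x + m * n) := by
  obtain ⟨a, rfl⟩ := Int.eq_ofNat_of_zero_le hl
  obtain ⟨b, hb⟩ := Int.eq_ofNat_of_zero_le (show 0 ≤ m - a - 1 by omega)
  have h1 := (shift_nat n r hrt a _ _).1 (chain_pos n r htr hrt x h b)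
  have e : x + ((b : ℤ) + 1) * n + a * n = x + m * n := by
    have : m = b + 1 + a := by omega
    rw [this]; ring
  rwa [e] at h1

theorem closed_of_order (n : ℤ) (hn : 1 ≤ n) (r : ℤ → ℤ → Prop)
    (htr : ∀ a b c, r a b → r b c → r a c) (hirr : ∀ a, ¬ r a a)
    (htri : ∀ a b, a ≠ b → r a b ∨ r b a)
    (hrt : ∀ i j : ℤ, r i j ↔ r (i + n) (j + n)) :
    IsClosedT n {p : ℤ × ℤ | p ∈ Ttil n ∧ r p.2 p.1} := by
  have up := chain_int n r htr hrt
  have down := chain_int n (fun a b => r b a) (fun a b c h1 h2 => htr _ _ _ h2 h1)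
    (fun i j => hrt j i)
  have step : ∀ x, r x (x + n) ∨ r (x + n) x := fun x => htri _ _ (by omega)
  refine ⟨fun p hp => hp.1, ?_, ?_, ?_⟩
  · rintro i j k hij hjk hd ⟨_, h1⟩ ⟨_, h2⟩
    exact ⟨⟨by dsimp only; omega, hd⟩, htr _ _ _ h2 h1⟩
  · rintro i j k hij hjk ⟨m, hm⟩ ⟨⟨_, d1⟩, h1⟩ ⟨⟨_, d2⟩, h2⟩ l hl
    dsimp only at d1 d2 h1 h2
    have hk : k = i + m * n := by linarith
    have hm0 : 0 < m := by
      by_contra hc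
      have : n * m ≤ 0 := mul_nonpos_of_nonneg_of_nonpos (by omega) (by omega)
      omega
    have hki : r k i := htr _ _ _ h2 h1
    have di : r (i + n) i := by
      rcases step i with h | h
      · have := up i h 0 m le_rfl hm0
        rw [zero_mul, add_zero, ← hk] at this
        exact absurd (htr _ _ _ hki this) (hirr _)
      · exact h
    have dj : r (j + n) j := by
      rcases step j with h | h
      · have h3 := up j h 0 m le_rfl hm0
        rw [zero_mul, add_zero] at h3
        obtain ⟨a, rfl⟩ := Int.eq_ofNat_of_zero_le hm0.le
        have h4 := (shift_nat n r hrt a _ _).1 h1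
        rw [← hk] at h4
        exact absurd (htr _ _ _ h3 (htr _ _ _ h4 h2)) (hirr _)
      · exact h
    have hln : 0 ≤ l * n := mul_nonneg hl (by omega)
    refine ⟨⟨⟨by dsimp only; omega, ?_⟩, ?_⟩, ⟨⟨by dsimp only; omega, ?_⟩, ?_⟩⟩
    · intro h
      apply d1
      have := dvd_sub h (Dvd.intro_left l rfl : n ∣ l * n)
      have e : j + l * n - i - l * n = j - i := by ring
      rwa [e] at this
    · rcases hl.eq_or_lt with rfl | h0
      · simpa using h1
      · have := down j dj 0 l le_rfl h0
        rw [zero_mul, add_zero] at this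
        exact htr _ _ _ this h1
    · intro h
      apply d2
      have := dvd_sub h (Dvd.intro_left l rfl : n ∣ l * n)
      have e : k + l * n - j - l * n = k - j := by ring
      rwa [e] at this
    · rcases hl.eq_or_lt with rfl | h0
      · simpa using h2
      · have := down i di m (m + l) hm0.le (by omega)
        have e : i + (m + l) * n = k + l * n := by rw [hk]; ring
        rw [← hk, e] at this
        exact htr _ _ _ this h2
  · rintro i j k hij hjk ⟨m, hm⟩ ⟨⟨_, d1⟩, h1⟩ ⟨_, h2⟩ l hl hlk
    dsimp only at d1 h1 h2
    have hk : k = j + m * n := by linarith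
    have hln : 0 ≤ l * n := mul_nonneg hl (by omega)
    have hlm : l ≤ m := by
      have : l * n ≤ m * n := by omega
      exact le_of_mul_le_mul_right this (by omega)
    refine ⟨⟨by dsimp only; omega, ?_⟩, ?_⟩
    · intro h
      apply d1
      have := dvd_sub h (Dvd.intro_left l rfl : n ∣ l * n)
      have e : j + l * n - i - l * n = j - i := by ring
      rwa [e] at this
    · dsimp only
      rcases step j with h | h
      · rcases hlm.eq_or_lt with rfl | h0
        · rwa [← hk]
        · have := up j h l m hl h0
          rw [← hk] at this
          exact htr _ _ _ this h2
      · rcases hl.eq_or_lt with rfl | h0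
        · simpa using h1
        · have := down j h 0 l le_rfl h0
          rw [zero_mul, add_zero] at this
          exact htr _ _ _ this h1

/-- For every translationally invariant total order `≺` on `ℤ`, the inversion set
`I(≺) = {(i,j) ∈ T̃ : j ≺ i}` is a translation-invariant biclosed subset of `T̃`. -/
theorem inversionSet_of_transInv_order_isBiclosed (n : ℤ) (hn : 1 ≤ n)
    (r : ℤ → ℤ → Prop) (hr : IsStrictTotalOrder ℤ r)
    (hrt : ∀ i j : ℤ, r i j ↔ r (i + n) (j + n)) :
    TransInv n {p : ℤ × ℤ | p ∈ Ttil n ∧ r p.2 p.1} ∧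
    IsBiclosedT n {p : ℤ × ℤ | p ∈ Ttil n ∧ r p.2 p.1} := by
  have htr : ∀ a b c, r a b → r b c → r a c := fun a b c h1 h2 => _root_.trans h1 h2
  have hirr : ∀ a, ¬ r a a := fun a => irrefl a
  have htri : ∀ a b, a ≠ b → r a b ∨ r b a := fun a b h => by
    rcases trichotomous_of r a b with h1 | h1 | h1
    · exact Or.inl h1
    · exact absurd h1 h
    · exact Or.inr h1
  refine ⟨?_, closed_of_order n hn r htr hirr htri hrt, ?_⟩
  · intro i j
    simp only [Ttil, Set.mem_setOf_eq]
    rw [hrt j i, add_sub_add_right_eq_sub, add_lt_add_iff_right]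
  · have h := closed_of_order n hn (fun a b => r b a) (fun a b c h1 h2 => htr _ _ _ h2 h1)
      hirr (fun a b hab => (htri a b hab).symm) (fun i j => hrt j i)
    have e : Ttil n \ {p : ℤ × ℤ | p ∈ Ttil n ∧ r p.2 p.1}
        = {p : ℤ × ℤ | p ∈ Ttil n ∧ r p.1 p.2} := by
      ext p
      simp only [Set.mem_diff, Set.mem_setOf_eq]
      constructor
      · rintro ⟨h1, h2⟩
        refine ⟨h1, (htri p.1 p.2 h1.1.ne).resolve_right fun h3 => h2 ⟨h1, h3⟩⟩
      · rintro ⟨h1, h2⟩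
        exact ⟨h1, fun h3 => hirr _ (htr _ _ _ h2 h3.2)⟩
    unfold IsCoclosedT
    rw [e]
    exact h
end

section
/- For every translation-invariant biclosed set B ⊆ T̃, there exists a translationally invariant total order ≺ on ℤ such that B = I(≺). -/
/-- Translation invariance under all multiples of `n`. -/
lemma inv_mul {n : ℤ} {R : ℤ → ℤ → Prop} (h : ∀ i j, R i j ↔ R (i + n) (j + n)) (m : ℤ) :
    ∀ i j, R i j ↔ R (i + n * m) (j + n * m) := by
  induction m using Int.induction_on with
  | zero => simp
  | succ k ih =>
    intro i j
    rw [ih, h]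
    ring_nf
  | pred k ih =>
    intro i j
    rw [ih, h (i + n * (-(k : ℤ) - 1))]
    ring_nf

lemma inv_dvd {n : ℤ} {R : ℤ → ℤ → Prop} (h : ∀ i j, R i j ↔ R (i + n) (j + n))
    {i j i' j' : ℤ} (hd : n ∣ i' - i) (he : i' - i = j' - j) (hR : R i j) : R i' j' := by
  obtain ⟨m, hm⟩ := hd
  have := (inv_mul h m i j).1 hR
  rwa [show i + n * m = i' by omega, show j + n * m = j' by omega] at this

/-- The tournament relation on non-congruent integers. -/
def tour (B C : Set (ℤ × ℤ)) (i j : ℤ) : Prop :=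
  (i < j ∧ (i, j) ∈ C) ∨ (j < i ∧ (j, i) ∈ B)

lemma tour_inv {n : ℤ} {B C : Set (ℤ × ℤ)} (hB : TransInv n B) (hC : TransInv n C) (i j : ℤ) :
    tour B C i j ↔ tour B C (i + n) (j + n) := by
  unfold tour
  rw [← hB, ← hC]
  simp

lemma tour_swap {B C : Set (ℤ × ℤ)} {i j : ℤ} : tour B C i j ↔ tour C B j i := by
  unfold tour
  tauto

lemma tour_asymm {B C : Set (ℤ × ℤ)} (hd : ∀ p, p ∈ B → p ∈ C → False) {i j : ℤ}
    (h : tour B C i j) (h' : tour B C j i) : False := by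
  unfold tour at h h'
  rcases h with ⟨h1, h2⟩ | ⟨h1, h2⟩ <;> rcases h' with ⟨h3, h4⟩ | ⟨h3, h4⟩
  · omega
  · exact hd _ h4 h2
  · exact hd _ h2 h4
  · omega

lemma tour_ndvd {n : ℤ} {B C : Set (ℤ × ℤ)} (hB : IsClosedT n B) (hC : IsClosedT n C) {i j : ℤ}
    (h : tour B C i j) : ¬ n ∣ j - i := by
  rcases h with ⟨_, h2⟩ | ⟨_, h2⟩
  · exact (hC.1 h2).2
  · have := (hB.1 h2).2
    rwa [dvd_sub_comm] at this

lemma tour_trans {n : ℤ} {B C : Set (ℤ × ℤ)} (hB : IsClosedT n B) (hC : IsClosedT n C)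
    (hd : ∀ p, p ∈ B → p ∈ C → False) (ht : ∀ p, p ∈ Ttil n → p ∈ B ∨ p ∈ C)
    {i j k : ℤ} (h : tour B C i j) (h' : tour B C j k) (hik : ¬ n ∣ k - i) : tour B C i k := by
  have hne : i ≠ k := by rintro rfl; simp at hik
  have hki : ¬ n ∣ i - k := by rwa [dvd_sub_comm]
  have hij := tour_ndvd hB hC h
  have hjk := tour_ndvd hB hC h'
  have hji : ¬ n ∣ i - j := by rwa [dvd_sub_comm]
  have hkj : ¬ n ∣ j - k := by rwa [dvd_sub_comm]
  rcases h with ⟨h1, h2⟩ | ⟨h1, h2⟩ <;> rcases h' with ⟨h3, h4⟩ | ⟨h3, h4⟩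
  · exact Or.inl ⟨by omega, hC.2.1 i j k h1 h3 hik h2 h4⟩
  · rcases lt_or_gt_of_ne hne with h5 | h5
    · rcases ht (i, k) ⟨h5, hik⟩ with h6 | h6
      · exact (hd _ (hB.2.1 i k j h5 h3 hij h6 h4) h2).elim
      · exact Or.inl ⟨h5, h6⟩
    · rcases ht (k, i) ⟨h5, hki⟩ with h6 | h6
      · exact Or.inr ⟨h5, h6⟩
      · exact (hd _ h4 (hC.2.1 k i j h5 h1 hkj h6 h2)).elim
  · rcases lt_or_gt_of_ne hne with h5 | h5
    · rcases ht (i, k) ⟨h5, hik⟩ with h6 | h6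
      · exact (hd _ (hB.2.1 j i k h1 h5 hjk h2 h6) h4).elim
      · exact Or.inl ⟨h5, h6⟩
    · rcases ht (k, i) ⟨h5, hki⟩ with h6 | h6
      · exact Or.inr ⟨h5, h6⟩
      · exact (hd _ h2 (hC.2.1 j k i h3 h5 hji h4 h6)).elim
  · exact Or.inr ⟨by omega, hB.2.1 k j i h3 h1 hki h4 h2⟩

/-- No pattern true-false-true along a residue class. -/
lemma tour_tft {n : ℤ} (hn : 1 ≤ n) {B C : Set (ℤ × ℤ)} (hB : IsClosedT n B) (hC : IsClosedT n C)
    (hBt : TransInv n B) (hCt : TransInv n C) (hd : ∀ p, p ∈ B → p ∈ C → False)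
    {i x y z : ℤ} (hxy : n ∣ y - x) (hyz : n ∣ z - y) (h1 : x < y) (h2 : y < z)
    (h3 : tour B C i x) (h4 : tour B C y i) (h5 : tour B C i z) : False := by
  obtain ⟨a, ha⟩ := hxy
  obtain ⟨b, hb⟩ := hyz
  have ha0 : 0 ≤ a := by by_contra h; nlinarith
  have hb0 : 0 ≤ b := by by_contra h; nlinarith
  have hBi := @inv_dvd n (fun i j => (i, j) ∈ B) hBt
  have hCi := @inv_dvd n (fun i j => (i, j) ∈ C) hCt
  have hxz : n ∣ z - x := ⟨a + b, by rw [mul_add]; omega⟩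
  have hza : a * n = y - x := by rw [ha]; ring
  have hzb : b * n = z - y := by rw [hb]; ring
  rcases h3 with ⟨h3, h3'⟩ | ⟨h3, h3'⟩ <;> rcases h4 with ⟨h4, h4'⟩ | ⟨h4, h4'⟩ <;>
    rcases h5 with ⟨h5, h5'⟩ | ⟨h5, h5'⟩ <;> try omega
  · have := hC.2.2.2 i x z h3 (by omega) hxz h3' h5' a ha0 (by omega)
    rw [show x + a * n = y by omega] at this
    exact hd _ h4' this
  · have := (hC.2.2.1 y i z h4 h5 ⟨b, hb⟩ h4' h5' a ha0).1
    exact hd _ (hBi (i' := y) (j' := i + a * n) ⟨a, ha⟩ (by omega) h3') this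
  · have h6 : (x, i + x - z) ∈ B :=
      hBi (i' := x) (j' := i + x - z) (by rwa [dvd_sub_comm]) (by omega) h5'
    have := hB.2.2.2 x (i + x - z) i (by omega) (by omega)
      (by rw [show i - (i + x - z) = z - x by ring]; exact hxz) h6 h3' b hb0 (by omega)
    exact hd _ (hBi (i' := y) (j' := i) ⟨a, ha⟩ (by omega) this) h4'
  · have := (hB.2.2.1 x i y h3 h4 ⟨a, ha⟩ h3' h4' b hb0).2
    rw [show y + b * n = z by omega] at this
    exact hd _ this h5'

/-- The residue class of `i` is compatible with the upward orientation. -/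
def UpT (n : ℤ) (R : ℤ → ℤ → Prop) (i : ℤ) : Prop :=
  ∀ x y, n ∣ y - x → x < y → R i x → R i y

/-- The residue class of `i` is compatible with the downward orientation. -/
def DnT (n : ℤ) (R : ℤ → ℤ → Prop) (i : ℤ) : Prop :=
  ∀ x y, n ∣ y - x → x < y → R i y → R i x

/-- The final order. -/
def ordT (n : ℤ) (R : ℤ → ℤ → Prop) (i j : ℤ) : Prop :=
  (¬ n ∣ j - i ∧ R i j) ∨ (n ∣ j - i ∧ ((UpT n R i ∧ i < j) ∨ (¬ UpT n R i ∧ j < i)))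

section abstract_part

variable {n : ℤ} {R : ℤ → ℤ → Prop}

lemma up_or_dn
    (inv : ∀ i j, R i j ↔ R (i + n) (j + n))
    (ndvd : ∀ i j, R i j → ¬ n ∣ j - i)
    (tot : ∀ i j, ¬ n ∣ j - i → R i j ∨ R j i)
    (asym : ∀ i j, R i j → R j i → False)
    (tr : ∀ i j k, R i j → R j k → ¬ n ∣ k - i → R i k)
    (tft : ∀ i x y z, n ∣ y - x → n ∣ z - y → x < y → y < z → R i x → R y i → R i z → False)
    (ftf : ∀ i x y z, n ∣ y - x → n ∣ z - y → x < y → y < z → R x i → R i y → R z i → False)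
    (i : ℤ) : UpT n R i ∨ DnT n R i := by
  by_contra hcon
  unfold UpT DnT at hcon
  push Not at hcon
  obtain ⟨⟨x, y, hxy, lxy, hx, hy⟩, u, v, huv, luv, hv, hu⟩ := hcon
  have ndx := ndvd _ _ hx
  have ndv := ndvd _ _ hv
  have ndy : ¬ n ∣ y - i := fun h => ndx (by
    have := dvd_sub h hxy; rwa [show y - i - (y - x) = x - i by ring] at this)
  have ndu : ¬ n ∣ u - i := fun h => ndv (by
    have := dvd_add h huv; rwa [show u - i + (v - u) = v - i by ring] at this)
  have hy' : R y i := (tot _ _ ndy).resolve_left hy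
  have hu' : R u i := (tot _ _ ndu).resolve_left hu
  by_cases hxu : n ∣ x - u
  · have hyv : n ∣ y - v := by
      have := dvd_sub (dvd_add hxu hxy) huv
      rwa [show x - u + (y - x) - (v - u) = y - v by ring] at this
    rcases lt_trichotomy y v with h | h | h
    · exact tft i x y v hxy (by rwa [dvd_sub_comm]) lxy h hx hy' hv
    · subst h; exact hy hv
    · exact ftf i u v y huv hyv luv h hu' hv hy'
  · set c := (y - x) + (v - u) with hc
    have hdc : n ∣ c := dvd_add hxy huv
    have ndxc : ¬ n ∣ (x + c) - i := fun h => ndx (by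
      have := dvd_sub h hdc; rwa [show x + c - i - c = x - i by ring] at this)
    have nduc : ¬ n ∣ (u + c) - i := fun h => ndu (by
      have := dvd_sub h hdc; rwa [show u + c - i - c = u - i by ring] at this)
    have h1 : R (x + c) i := (tot _ _ ndxc).resolve_left fun h =>
      tft i x y (x + c) hxy (by rwa [show x + c - y = v - u by omega]) lxy (by omega) hx hy' h
    have h2 : R i (u + c) := by
      refine (tot _ _ nduc).resolve_right fun h => ?_
      exact ftf i u v (u + c) huv (by rwa [show u + c - v = y - x by omega]) luv (by omega)
        hu' hv h
    have h3 : R u x := tr _ _ _ hu' hx hxu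
    have h4 : R (x + c) (u + c) := tr _ _ _ h1 h2 (by
      rw [show u + c - (x + c) = u - x by ring, dvd_sub_comm]; exact hxu)
    have h5 : R x u := inv_dvd inv (i' := x) (j' := u)
      (by rw [show x - (x + c) = -c by ring]; exact (dvd_neg).2 hdc) (by ring) h4
    exact asym _ _ h3 h5

lemma up_congr (inv : ∀ i j, R i j ↔ R (i + n) (j + n)) {i j : ℤ} (hij : n ∣ j - i)
    (h : UpT n R i) : UpT n R j := by
  intro x y hxy lxy hx
  have h1 : R i (x - (j - i)) := inv_dvd inv (by rwa [dvd_sub_comm]) (by ring) hx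
  have h2 := h (x - (j - i)) (y - (j - i))
    (by rwa [show y - (j - i) - (x - (j - i)) = y - x by ring]) (by omega) h1
  exact inv_dvd inv hij (by ring) h2

lemma ordT_main
    (inv : ∀ i j, R i j ↔ R (i + n) (j + n))
    (tot : ∀ i j, ¬ n ∣ j - i → R i j ∨ R j i)
    (asym : ∀ i j, R i j → R j i → False)
    (tr : ∀ i j k, R i j → R j k → ¬ n ∣ k - i → R i k)
    (ud : ∀ i, UpT n R i ∨ DnT n R i) :
    IsStrictTotalOrder ℤ (ordT n R) ∧ (∀ i j : ℤ, ordT n R i j ↔ ordT n R (i + n) (j + n)) := by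
  have upc : ∀ {i j : ℤ}, n ∣ j - i → (UpT n R i ↔ UpT n R j) := fun {i j} h =>
    ⟨up_congr inv h, up_congr inv (by rwa [dvd_sub_comm])⟩
  have irr : ∀ i, ¬ ordT n R i i := by
    intro i h
    simp [ordT] at h
  have tri : ∀ i j, ordT n R i j ∨ i = j ∨ ordT n R j i := by
    intro i j
    by_cases h : n ∣ j - i
    · have h' : n ∣ i - j := by rwa [dvd_sub_comm]
      have := upc h
      unfold ordT
      rcases lt_trichotomy i j with h1 | h1 | h1 <;> by_cases h2 : UpT n R i <;> tauto
    · have h' : ¬ n ∣ i - j := by rwa [dvd_sub_comm]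
      have := tot i j h
      unfold ordT
      tauto
  have trn : ∀ i j k, ordT n R i j → ordT n R j k → ordT n R i k := by
    intro i j k hij hjk
    rcases hij with ⟨d1, hij⟩ | ⟨d1, hij⟩ <;> rcases hjk with ⟨d2, hjk⟩ | ⟨d2, hjk⟩
    · by_cases d3 : n ∣ k - i
      · refine Or.inr ⟨d3, ?_⟩
        have hne : i ≠ k := by
          rintro rfl; exact asym _ _ hij hjk
        have d3' : n ∣ i - k := by rwa [dvd_sub_comm]
        have h1 : R k (j + (k - i)) := inv_dvd inv d3 (by ring) hij
        by_cases hu : UpT n R i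
        · refine Or.inl ⟨hu, ?_⟩
          by_contra hlt
          have hk : UpT n R k := (upc d3).1 hu
          exact asym _ _ hjk (hk (j + (k - i)) j
            (by rwa [show j - (j + (k - i)) = i - k by ring]) (by omega) h1)
        · refine Or.inr ⟨hu, ?_⟩
          by_contra hlt
          have hk : DnT n R k := (ud k).resolve_left fun h => hu ((upc d3).2 h)
          exact asym _ _ hjk (hk j (j + (k - i))
            (by rwa [show j + (k - i) - j = k - i by ring]) (by omega) h1)
      · exact Or.inl ⟨d3, tr _ _ _ hij hjk d3⟩
    · have d3 : ¬ n ∣ k - i := fun h => d1 (by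
        have := dvd_sub h d2; rwa [show k - i - (k - j) = j - i by ring] at this)
      refine Or.inl ⟨d3, (tot _ _ d3).resolve_right fun hki => ?_⟩
      have d2' : n ∣ j - k := by rwa [dvd_sub_comm]
      have h1 : R j (i + (j - k)) := inv_dvd inv d2' (by ring) hki
      rcases hjk with ⟨hu, hl⟩ | ⟨hu, hl⟩
      · exact asym _ _ hij (hu (i + (j - k)) i
          (by rwa [show i - (i + (j - k)) = k - j by ring]) (by omega) h1)
      · exact asym _ _ hij ((ud j).resolve_left hu i (i + (j - k))
          (by rwa [show i + (j - k) - i = j - k by ring]) (by omega) h1)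
    · have d3 : ¬ n ∣ k - i := fun h => d2 (by
        have := dvd_sub h d1; rwa [show k - i - (j - i) = k - j by ring] at this)
      refine Or.inl ⟨d3, ?_⟩
      have d1' : n ∣ i - j := by rwa [dvd_sub_comm]
      have h1 : R i (k + (i - j)) := inv_dvd inv d1' (by ring) hjk
      rcases hij with ⟨hu, hl⟩ | ⟨hu, hl⟩
      · exact hu (k + (i - j)) k
          (by rwa [show k - (k + (i - j)) = j - i by ring]) (by omega) h1
      · exact (ud i).resolve_left hu k (k + (i - j))
          (by rwa [show k + (i - j) - k = i - j by ring]) (by omega) h1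
    · have d3 : n ∣ k - i := by
        have := dvd_add d1 d2; rwa [show j - i + (k - j) = k - i by ring] at this
      refine Or.inr ⟨d3, ?_⟩
      have := upc d1
      rcases hij with ⟨hu, hl⟩ | ⟨hu, hl⟩ <;> rcases hjk with ⟨hu', hl'⟩ | ⟨hu', hl'⟩
      · exact Or.inl ⟨hu, by omega⟩
      · tauto
      · tauto
      · exact Or.inr ⟨hu, by omega⟩
  refine ⟨{ irrefl := irr, trans := trn, trichotomous := ?_ }, ?_⟩
  · intro a b h1 h2
    have := tri a b
    tauto
  · intro i j
    have := upc (i := i) (j := i + n) (by simp)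
    unfold ordT
    rw [← inv, ← this]
    simp

end abstract_part

/-- Every translation-invariant biclosed set `B ⊆ T̃` is the inversion set of some
translationally invariant total order on `ℤ`. -/
theorem biclosedT_eq_inversionSet_of_some_order (n : ℤ) (hn : 1 ≤ n)
    (B : Set (ℤ × ℤ)) (hB : B ⊆ Ttil n) (hBt : TransInv n B)
    (hbc : IsBiclosedT n B) :
    ∃ r : ℤ → ℤ → Prop, IsStrictTotalOrder ℤ r ∧
      (∀ i j : ℤ, r i j ↔ r (i + n) (j + n)) ∧
      B = {p : ℤ × ℤ | p ∈ Ttil n ∧ r p.2 p.1} := by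
  obtain ⟨hBc, hCc⟩ := hbc
  unfold IsCoclosedT at hCc
  have hd : ∀ p, p ∈ B → p ∈ Ttil n \ B → False := fun p h h' => h'.2 h
  have ht : ∀ p, p ∈ Ttil n → p ∈ B ∨ p ∈ Ttil n \ B := fun p h => by
    by_cases h' : p ∈ B
    · exact Or.inl h'
    · exact Or.inr ⟨h, h'⟩
  have hCt : TransInv n (Ttil n \ B) := by
    intro i j
    have := hBt i j
    simp only [Set.mem_sdiff, Ttil, Set.mem_ofPred_eq, ← this]
    simp
  generalize Ttil n \ B = C at *
  have hd' : ∀ p, p ∈ C → p ∈ B → False := fun p h h' => hd p h' h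
  have inv := tour_inv hBt hCt
  have asym : ∀ i j, tour B C i j → tour B C j i → False := fun i j => tour_asymm hd
  have tr : ∀ i j k, tour B C i j → tour B C j k → ¬ n ∣ k - i → tour B C i k :=
    fun i j k => tour_trans hBc hCc hd ht
  have tot : ∀ i j, ¬ n ∣ j - i → tour B C i j ∨ tour B C j i := by
    intro i j h
    have h' : ¬ n ∣ i - j := by rwa [dvd_sub_comm]
    have hne : i ≠ j := by rintro rfl; simp at h
    unfold tour
    rcases lt_or_gt_of_ne hne with h1 | h1
    · have := ht (i, j) ⟨h1, h⟩
      tauto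
    · have := ht (j, i) ⟨h1, h'⟩
      tauto
  have ud := up_or_dn inv (fun i j => tour_ndvd hBc hCc) tot asym tr
    (fun i x y z a b c d e f g => tour_tft hn hBc hCc hBt hCt hd a b c d e f g)
    (fun i x y z a b c d e f g => tour_tft hn hCc hBc hCt hBt hd' a b c d
      (tour_swap.1 e) (tour_swap.1 f) (tour_swap.1 g))
  obtain ⟨h1, h2⟩ := ordT_main inv tot asym tr ud
  refine ⟨_, h1, h2, ?_⟩
  ext ⟨i, j⟩
  constructor
  · intro h
    have hT := hB h
    refine ⟨hT, Or.inl ⟨?_, Or.inr ⟨hT.1, h⟩⟩⟩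
    have := hT.2
    rwa [dvd_sub_comm] at this
  · rintro ⟨⟨hl, hnd⟩, ⟨_, h⟩ | ⟨h, _⟩⟩
    · simp only at hl hnd h
      rcases h with ⟨h, _⟩ | ⟨_, h⟩
      · omega
      · exact h
    · rw [dvd_sub_comm] at h
      exact (hnd h).elim
end

section
/- Let ≺₁ and ≺₂ be translationally invariant total orders on ℤ with I(≺₁) = I(≺₂). Then for every integer r, either ≺₁ and ≺₂ agree on the residue class r + nℤ (for all p, q ∈ r + nℤ, p ≺₁ q ⟺ p ≺₂ q), or ≺₂ is the reverse of ≺₁ on r + nℤ (for all p, q ∈ r + nℤ, p ≺₁ q ⟺ q ≺₂ p) and r + nℤ is an interval for ≺₁, meaning there are no integers x ∉ r + nℤ and p, q ∈ r + nℤ with p ≺₁ x and x ≺₁ q. -/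
theorem aux_inc (n : ℤ) (hn : 1 ≤ n) (R : ℤ → ℤ → Prop) (h : IsStrictTotalOrder ℤ R)
    (ht : ∀ i j : ℤ, R i j ↔ R (i + n) (j + n)) (r : ℤ) (h0 : R r (r + n)) :
    ∀ p q : ℤ, n ∣ (p - r) → n ∣ (q - r) → (R p q ↔ p < q) := by
  have step : ∀ k : ℤ, R (r + k * n) (r + k * n + n) := by
    intro k
    induction k using Int.induction_on with
    | zero => simpa using h0
    | succ i ih =>
      have := (ht _ _).1 ih
      have e : r + ((i : ℤ) + 1) * n = r + i * n + n := by ring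
      rw [e]; exact this
    | pred i ih =>
      rw [ht]
      have e : r + (-(i : ℤ) - 1) * n + n = r + (-(i : ℤ)) * n := by ring
      rw [e]; exact ih
  have key : ∀ k : ℤ, ∀ m : ℕ, R (r + k * n) (r + (k + m + 1) * n) := by
    intro k m
    induction m with
    | zero =>
      have e : r + (k + (0 : ℕ) + 1) * n = r + k * n + n := by push_cast; ring
      rw [e]; exact step k
    | succ m ih =>
      have e : r + (k + (m + 1 : ℕ) + 1) * n = r + (k + m + 1) * n + n := by push_cast; ring
      rw [e]; exact _root_.trans ih (step _)
  have lt : ∀ p q : ℤ, n ∣ (p - r) → n ∣ (q - r) → p < q → R p q := by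
    rintro p q ⟨a, ha⟩ ⟨b, hb⟩ hpq
    have hab : a < b := by
      by_contra hc
      have : n * b ≤ n * a := mul_le_mul_of_nonneg_left (by omega) (by omega)
      omega
    have := key a (b - a - 1).toNat
    have e1 : r + a * n = p := by rw [mul_comm]; omega
    have e2 : r + (a + ((b - a - 1).toNat : ℤ) + 1) * n = q := by
      rw [Int.toNat_of_nonneg (by omega)]
      have : a + (b - a - 1) + 1 = b := by ring
      rw [this, mul_comm]; omega
    rwa [e1, e2] at this
  intro p q hp hq
  refine ⟨fun hR => ?_, lt p q hp hq⟩
  by_contra hc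
  rcases (not_lt.1 hc).lt_or_eq with h' | h'
  · exact irrefl p (_root_.trans hR (lt q p hq hp h'))
  · subst h'; exact irrefl _ hR

theorem aux_class (n : ℤ) (hn : 1 ≤ n) (R : ℤ → ℤ → Prop) (h : IsStrictTotalOrder ℤ R)
    (ht : ∀ i j : ℤ, R i j ↔ R (i + n) (j + n)) (r : ℤ) :
    (∀ p q : ℤ, n ∣ (p - r) → n ∣ (q - r) → (R p q ↔ p < q)) ∨
    (∀ p q : ℤ, n ∣ (p - r) → n ∣ (q - r) → (R p q ↔ q < p)) := by
  rcases trichotomous_of R r (r + n) with h' | h' | h'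
  · exact Or.inl (aux_inc n hn R h ht r h')
  · omega
  · right
    have hs : IsStrictTotalOrder ℤ (Function.swap R) := IsStrictTotalOrder.swap R
    intro p q hp hq
    exact aux_inc n hn (Function.swap R) hs (fun i j => ht j i) r h' q p hq hp

/-- If two translationally invariant total orders on `ℤ` have the same inversion
set, then on each residue class `r + nℤ` they either agree, or are reverses of
each other and the class is an interval for the first order. -/
theorem orders_with_same_inversions_agree_or_reverse_on_classes
    (n : ℤ) (hn : 1 ≤ n)
    (r₁ r₂ : ℤ → ℤ → Prop)
    (h₁ : IsStrictTotalOrder ℤ r₁) (h₂ : IsStrictTotalOrder ℤ r₂)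
    (h₁t : ∀ i j : ℤ, r₁ i j ↔ r₁ (i + n) (j + n))
    (h₂t : ∀ i j : ℤ, r₂ i j ↔ r₂ (i + n) (j + n))
    (hI : {p : ℤ × ℤ | p ∈ Ttil n ∧ r₁ p.2 p.1} =
          {p : ℤ × ℤ | p ∈ Ttil n ∧ r₂ p.2 p.1}) :
    ∀ r : ℤ,
      (∀ p q : ℤ, n ∣ (p - r) → n ∣ (q - r) → (r₁ p q ↔ r₂ p q)) ∨
      ((∀ p q : ℤ, n ∣ (p - r) → n ∣ (q - r) → (r₁ p q ↔ r₂ q p)) ∧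
        ¬ ∃ x p q : ℤ, ¬ (n ∣ (x - r)) ∧ n ∣ (p - r) ∧ n ∣ (q - r) ∧
          r₁ p x ∧ r₁ x q) := by
  have half : ∀ x y : ℤ, x < y → ¬ n ∣ (y - x) → (r₁ y x ↔ r₂ y x) := by
    intro x y hxy hd
    have := Set.ext_iff.1 hI (x, y)
    simp only [Set.mem_setOf_eq, Ttil] at this
    tauto
  have flip : ∀ x y : ℤ, ¬ n ∣ (y - x) → (r₁ x y → r₂ x y) := by
    intro x y hd hr
    rcases lt_trichotomy x y with hxy | hxy | hxy
    · rcases trichotomous_of r₂ x y with h' | h' | h'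
      · exact h'
      · omega
      · exact absurd (_root_.trans hr ((half x y hxy hd).2 h')) (irrefl x)
    · subst hxy; simp at hd
    · exact (half y x hxy (fun hc => hd (by rwa [dvd_sub_comm]))).1 hr
  intro r
  have opp : (∀ p q : ℤ, n ∣ (p - r) → n ∣ (q - r) → (r₁ p q ↔ r₂ q p)) →
      ¬ ∃ x p q : ℤ, ¬ (n ∣ (x - r)) ∧ n ∣ (p - r) ∧ n ∣ (q - r) ∧ r₁ p x ∧ r₁ x q := by
    rintro ho ⟨x, p, q, hx, hp, hq, hpx, hxq⟩
    have a1 : r₂ p x := flip p x (fun hc => hx (by simpa using dvd_add hc hp)) hpx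
    have a2 : r₂ x q := flip x q (fun hc => hx (by simpa using dvd_sub hq hc)) hxq
    have a3 : r₂ q p := (ho p q hp hq).1 (_root_.trans hpx hxq)
    exact irrefl p (_root_.trans (_root_.trans a1 a2) a3)
  rcases aux_class n hn r₁ h₁ h₁t r with H₁ | H₁ <;>
    rcases aux_class n hn r₂ h₂ h₂t r with H₂ | H₂
  · left; intro p q hp hq; rw [H₁ p q hp hq, H₂ p q hp hq]
  · have ho : ∀ p q : ℤ, n ∣ (p - r) → n ∣ (q - r) → (r₁ p q ↔ r₂ q p) := by
      intro p q hp hq; rw [H₁ p q hp hq, H₂ q p hq hp]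
    exact Or.inr ⟨ho, opp ho⟩
  · have ho : ∀ p q : ℤ, n ∣ (p - r) → n ∣ (q - r) → (r₁ p q ↔ r₂ q p) := by
      intro p q hp hq; rw [H₁ p q hp hq, H₂ q p hq hp]
    exact Or.inr ⟨ho, opp ho⟩
  · left; intro p q hp hq; rw [H₁ p q hp hq, H₂ p q hp hq]
end

section
/- Let B ⊆ T̃ be a translation-invariant biclosed set and let (i,j) ∈ T̃. Then the set {ℓ ∈ ℕ : (i, j + ℓn) ∈ B} is either finite or cofinite in ℕ; that is, either (i, j+ℓn) ∈ B for all sufficiently large ℓ, or (i, j+ℓn) ∉ B for all sufficiently large ℓ. -/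
/-- For a translation-invariant biclosed set `B ⊆ T̃` and `(i,j) ∈ T̃`, either
`(i, j+ℓn) ∈ B` for all sufficiently large `ℓ ∈ ℕ`, or `(i, j+ℓn) ∉ B` for all
sufficiently large `ℓ ∈ ℕ`. -/
theorem eventually_mem_or_eventually_not_mem (n : ℤ) (hn : 1 ≤ n)
    (B : Set (ℤ × ℤ)) (hB : B ⊆ Ttil n) (hBt : TransInv n B)
    (hbc : IsBiclosedT n B) (i j : ℤ) (hij : (i, j) ∈ Ttil n) :
    (∃ L : ℕ, ∀ l : ℕ, L ≤ l → (i, j + (l : ℤ) * n) ∈ B) ∨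
    (∃ L : ℕ, ∀ l : ℕ, L ≤ l → (i, j + (l : ℤ) * n) ∉ B) := by
  by_contra hcon
  push Not at hcon
  obtain ⟨h1, h2⟩ := hcon
  obtain ⟨a, -, ha⟩ := h2 0
  obtain ⟨b, hab, hb⟩ := h1 a
  obtain ⟨c, hbc', hc⟩ := h2 (b + 1)
  apply hb
  have h3 := hbc.1.2.2.2
  have hab' : (a : ℤ) ≤ b := by exact_mod_cast hab
  have hbc'' : (b : ℤ) + 1 ≤ c := by exact_mod_cast hbc'
  have key := h3 i (j + a * n) (j + c * n) (hB ha).1 (by nlinarith)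
    ⟨(c : ℤ) - a, by ring⟩ ha hc ((b : ℤ) - a) (by linarith) (by nlinarith)
  have e : j + (a : ℤ) * n + ((b : ℤ) - a) * n = j + b * n := by ring
  rwa [e] at key
end

section
/- Two translation-invariant biclosed sets B, C ⊆ T̃ are commensurable if and only if B_∞ = C_∞. -/
/-- For a translation-invariant `B ⊆ T̃` and residues `a ≠ b mod n`, the pair
`(a,b)` lies in `B_∞` if `(i,j) ∈ B` for all `i ≡ a`, `j ≡ b (mod n)` with
`j - i` sufficiently large. -/
def MemBinfty (n : ℤ) (B : Set (ℤ × ℤ)) (a b : ℤ) : Prop :=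
  ∃ M : ℤ, ∀ i j : ℤ, n ∣ (i - a) → n ∣ (j - b) → M ≤ j - i → (i, j) ∈ B

/-- Translation-invariant sets `B, C ⊆ T̃` are commensurable if their symmetric
difference contains only finitely many pairs with first entry in `[0, n)`. -/
def Commensurable' (n : ℤ) (B C : Set (ℤ × ℤ)) : Prop :=
  {p ∈ (B \ C) ∪ (C \ B) | 0 ≤ p.1 ∧ p.1 < n}.Finite

theorem TransInv.mul {n : ℤ} {B : Set (ℤ × ℤ)} (h : TransInv n B) (i j m : ℤ) :
    (i, j) ∈ B ↔ (i + m * n, j + m * n) ∈ B := by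
  induction m using Int.induction_on with
  | zero => simp
  | succ k ih =>
    rw [ih, h]
    ring_nf
  | pred k ih =>
    rw [ih, h (i + (-(k : ℤ) - 1) * n)]
    ring_nf

theorem eventually_out {n : ℤ} (hn : 1 ≤ n) {B : Set (ℤ × ℤ)} (ht : TransInv n B)
    (hc : IsClosedT n B) (i b : ℤ) (h : ¬ MemBinfty n B i b) :
    ∃ K : ℤ, ∀ j : ℤ, K ≤ j → n ∣ (j - b) → (i, j) ∉ B := by
  by_contra! hK
  apply h
  obtain ⟨j0, hj0, hd0, hB0⟩ := hK (i + 1)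
  have key : ∀ j, j0 ≤ j → n ∣ (j - b) → (i, j) ∈ B := by
    intro j hj hd
    obtain ⟨j1, hj1, hd1, hB1⟩ := hK (j + 1)
    obtain ⟨l, hl⟩ : n ∣ j - j0 := by
      have := dvd_sub hd hd0
      simpa using this
    have hl0 : 0 ≤ l := by
      by_contra! hneg
      nlinarith
    have e : j = j0 + l * n := by linarith [mul_comm n l]
    rw [e]
    refine hc.2.2.2 i j0 j1 (by lia) (by lia) ?_ hB0 hB1 l hl0 (by rw [← e]; lia)
    have := dvd_sub hd1 hd0
    simpa using this
  refine ⟨j0 - i, fun i' j' hi' hj' hM => ?_⟩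
  obtain ⟨m, hm⟩ := hi'
  rw [ht.mul i' j' (-m)]
  have e : i' + -m * n = i := by linarith [mul_comm n m]
  rw [e]
  apply key
  · linarith
  · have : j' + -m * n - b = (j' - b) + n * (-m) := by ring
    rw [this]
    exact dvd_add hj' (dvd_mul_right _ _)

theorem binfty_mono {n : ℤ} (hn : 1 ≤ n) {B C : Set (ℤ × ℤ)}
    (hBt : TransInv n B) (hCt : TransInv n C)
    (hf : {p ∈ (B \ C) ∪ (C \ B) | 0 ≤ p.1 ∧ p.1 < n}.Finite) (a b : ℤ)
    (h : MemBinfty n B a b) : MemBinfty n C a b := by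
  obtain ⟨M, hM⟩ := h
  obtain ⟨K, hK⟩ := (hf.image Prod.snd).bddAbove
  refine ⟨max M (K + 1), fun i j hi hj hij => ?_⟩
  have h1 : M ≤ j - i := le_trans (le_max_left _ _) hij
  have h2 : K + 1 ≤ j - i := le_trans (le_max_right _ _) hij
  have hb := hM i j hi hj h1
  rw [hBt.mul i j (-(i / n))] at hb
  rw [hCt.mul i j (-(i / n))]
  have e : i + -(i / n) * n = i % n := by
    have := Int.mul_ediv_add_emod i n
    linarith [mul_comm n (i / n)]
  have p0 : 0 ≤ i % n := Int.emod_nonneg _ (by lia)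
  have p1 : i % n < n := Int.emod_lt_of_pos _ (by lia)
  by_contra hcc
  have := hK ⟨_, ⟨Or.inl ⟨hb, hcc⟩, by simpa only [e] using p0, by simpa only [e] using p1⟩, rfl⟩
  simp only at this
  linarith

theorem eventually_eq {n : ℤ} (hn : 1 ≤ n) {B C : Set (ℤ × ℤ)} (hB : B ⊆ Ttil n) (hC : C ⊆ Ttil n)
    (hBt : TransInv n B) (hCt : TransInv n C) (hBc : IsClosedT n B) (hCc : IsClosedT n C)
    (h : ∀ a b : ℤ, ¬ (n ∣ (b - a)) → (MemBinfty n B a b ↔ MemBinfty n C a b)) (i b : ℤ) :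
    ∃ K : ℤ, ∀ j : ℤ, K ≤ j → n ∣ (j - b) → ((i, j) ∈ B ↔ (i, j) ∈ C) := by
  by_cases hd : n ∣ b - i
  · refine ⟨0, fun j _ hj => ?_⟩
    have hji : n ∣ j - i := by
      have := dvd_add hj hd
      simpa using this
    exact ⟨fun hx => absurd hji (hB hx).2, fun hx => absurd hji (hC hx).2⟩
  · by_cases hm : MemBinfty n B i b
    · obtain ⟨M, hM⟩ := hm
      obtain ⟨N, hN⟩ := (h i b hd).1 ⟨M, hM⟩
      refine ⟨max M N + i, fun j hj hjb => ?_⟩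
      have h1 := le_max_left M N
      have h2 := le_max_right M N
      exact ⟨fun _ => hN i j (by simp) hjb (by linarith), fun _ => hM i j (by simp) hjb (by linarith)⟩
    · obtain ⟨M, hM⟩ := eventually_out hn hBt hBc i b hm
      obtain ⟨N, hN⟩ := eventually_out hn hCt hCc i b (fun hx => hm ((h i b hd).2 hx))
      refine ⟨max M N, fun j hj hjb => ?_⟩
      have h1 := le_max_left M N
      have h2 := le_max_right M N
      exact iff_of_false (hM j (by linarith) hjb) (hN j (by linarith) hjb)

/-- Two translation-invariant biclosed sets `B, C ⊆ T̃` are commensurable if and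
only if `B_∞ = C_∞`. -/
theorem commensurable_iff_binfty_eq (n : ℤ) (hn : 1 ≤ n)
    (B C : Set (ℤ × ℤ)) (hB : B ⊆ Ttil n) (hC : C ⊆ Ttil n)
    (hBt : TransInv n B) (hCt : TransInv n C)
    (hBbc : IsBiclosedT n B) (hCbc : IsBiclosedT n C) :
    Commensurable' n B C ↔
      ∀ a b : ℤ, ¬ (n ∣ (b - a)) → (MemBinfty n B a b ↔ MemBinfty n C a b) := by
  constructor
  · intro hf a b _
    refine ⟨binfty_mono hn hBt hCt hf a b, binfty_mono hn hCt hBt ?_ a b⟩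
    rw [Set.union_comm]
    exact hf
  · intro h
    choose K hK using eventually_eq hn hB hC hBt hCt hBbc.1 hCbc.1 h
    obtain ⟨L, hL⟩ := (((Set.finite_Icc (0 : ℤ) n).prod (Set.finite_Icc (0 : ℤ) n)).image
      (fun p : ℤ × ℤ => K p.1 p.2)).bddAbove
    refine ((Set.finite_Icc (0 : ℤ) n).prod (Set.finite_Icc (0 : ℤ) L)).subset ?_
    rintro ⟨i, j⟩ ⟨hp, h0, h1⟩
    simp only at h0 h1
    have hij : i < j := by
      rcases hp with hp | hp
      · exact (hB hp.1).1
      · exact (hC hp.1).1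
    refine ⟨⟨h0, h1.le⟩, by simp only; lia, ?_⟩
    simp only
    by_contra! hlt
    have p0 : 0 ≤ j % n := Int.emod_nonneg _ (by lia)
    have p1 : j % n < n := Int.emod_lt_of_pos _ (by lia)
    have hk : K i (j % n) ≤ L := hL ⟨(i, j % n), ⟨⟨h0, h1.le⟩, ⟨p0, p1.le⟩⟩, rfl⟩
    have := hK i (j % n) j (by linarith) (Int.dvd_self_sub_emod)
    rcases hp with hp | hp
    · exact hp.2 (this.1 hp.1)
    · exact hp.2 (this.2 hp.1)
end

section
/- Let B ⊆ T̃ be a translation-invariant biclosed set. Then B_∞ is biclosed in the finite type-A root system; that is, for all pairwise distinct residues a, b, c in ℤ/nℤ: if (a,b) ∈ B_∞ and (b,c) ∈ B_∞ then (a,c) ∈ B_∞, and if (a,b) ∉ B_∞ and (b,c) ∉ B_∞ then (a,c) ∉ B_∞. -/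
theorem aux_dvd {n x y : ℤ} (h : n ∣ x) (e : y = x) : n ∣ y := e ▸ h

theorem aux_tr (n : ℤ) (B : Set (ℤ × ℤ)) (hBt : TransInv n B) (i j t : ℤ) :
    (i, j) ∈ B ↔ (i + t * n, j + t * n) ∈ B := by
  induction t using Int.induction_on with
  | zero => simp
  | succ t ih =>
    rw [ih, hBt]
    ring_nf
  | pred t ih =>
    rw [ih, hBt (i + (-(t:ℤ) - 1) * n)]
    ring_nf

theorem aux_trans (n : ℤ) (hn : 1 ≤ n) (B : Set (ℤ × ℤ)) (hc : IsClosedT n B)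
    (a b c : ℤ) (hac : ¬ (n ∣ (c - a))) (h1 : MemBinfty n B a b) (h2 : MemBinfty n B b c) :
    MemBinfty n B a c := by
  obtain ⟨M1, h1⟩ := h1
  obtain ⟨M2, h2⟩ := h2
  refine ⟨max M1 1 + max M2 1 + n, fun i k hi hk hik => ?_⟩
  have hm1 := le_max_left M1 1
  have hm1' := le_max_right M1 1
  have hm2 := le_max_left M2 1
  have hm2' := le_max_right M2 1
  set m1 := max M1 1
  set m2 := max M2 1
  have e1 := Int.emod_nonneg (b - (i + m1)) (by omega : n ≠ 0)
  have e2 := Int.emod_lt_of_pos (b - (i + m1)) (by omega : 0 < n)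
  have e3 : n ∣ (b - (i + m1)) - (b - (i + m1)) % n := Int.dvd_self_sub_emod
  set r := (b - (i + m1)) % n
  have hj : n ∣ (i + m1 + r) - b := by
    have := (dvd_neg).2 e3
    refine aux_dvd this ?_
    ring
  refine hc.2.1 i (i + m1 + r) k (by omega) (by omega) ?_
    (h1 _ _ hi hj (by omega)) (h2 _ _ hj hk (by omega))
  intro h
  apply hac
  have := dvd_sub (dvd_add h hi) hk
  refine aux_dvd this ?_
  ring

theorem aux_compl (n : ℤ) (hn : 1 ≤ n) (B : Set (ℤ × ℤ)) (hBt : TransInv n B)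
    (hc : IsCoclosedT n B) (a b : ℤ) (hab : ¬ (n ∣ (b - a))) (h : ¬ MemBinfty n B a b) :
    MemBinfty n (Ttil n \ B) a b := by
  have key : ∀ i0, n ∣ (i0 - a) → ∀ M, ∃ j, n ∣ (j - b) ∧ M ≤ j - i0 ∧ (i0, j) ∉ B := by
    intro i0 hi0 M
    by_contra hcon
    push Not at hcon
    apply h
    refine ⟨M, fun i j hi hj hij => ?_⟩
    obtain ⟨t, ht⟩ := dvd_sub hi0 hi
    rw [aux_tr n B hBt i j t]
    have e : i + t * n = i0 := by linarith
    rw [e]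
    apply hcon
    · have := dvd_add hj (dvd_mul_left n t)
      refine aux_dvd this ?_
      ring
    · linarith
  have hT : ∀ i j, n ∣ (i - a) → n ∣ (j - b) → i < j → (i, j) ∈ Ttil n := by
    intro i j hi hj hij
    refine ⟨hij, fun hd => hab ?_⟩
    have := dvd_sub (dvd_add hd hi) hj
    refine aux_dvd this ?_
    ring
  obtain ⟨j, hj, hj1, hjB⟩ := key a (by simp) 1
  refine ⟨j - a, fun i k hi hk hik => ?_⟩
  obtain ⟨t, ht⟩ := hi
  refine ⟨hT i k ⟨t, ht⟩ hk (by omega), ?_⟩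
  rw [aux_tr n B hBt i k (-t)]
  have e : i + -t * n = a := by linarith
  rw [e]
  have hk' : n ∣ (k + -t * n) - b := by
    have := dvd_add hk (dvd_mul_left n (-t))
    refine aux_dvd this ?_
    ring
  have hk2 : j ≤ k + -t * n := by linarith
  generalize k + -t * n = m at hk' hk2
  obtain ⟨p, hp, hp1, hpB⟩ := key a (by simp) (m + 1 - a)
  have hpj : n ∣ p - j := by
    have := dvd_sub hp hj
    refine aux_dvd this ?_
    ring
  obtain ⟨l, hl⟩ := dvd_sub hk' hj
  have em : m = j + l * n := by linarith
  rcases le_or_gt 0 l with hl0 | hl0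
  · have := hc.2.2.2 a j p (by omega) (by omega) hpj
        ⟨hT _ _ (by simp) hj (by omega), hjB⟩ ⟨hT _ _ (by simp) hp (by omega), hpB⟩
        l hl0 (by omega)
    rw [em]
    exact this.2
  · have : m = j := by nlinarith
    rw [this]
    exact hjB

theorem binfty_biclosed (n : ℤ) (hn : 1 ≤ n)
    (B : Set (ℤ × ℤ)) (hB : B ⊆ Ttil n) (hBt : TransInv n B)
    (hbc : IsBiclosedT n B) :
    ∀ a b c : ℤ, ¬ (n ∣ (b - a)) → ¬ (n ∣ (c - b)) → ¬ (n ∣ (c - a)) →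
      ((MemBinfty n B a b → MemBinfty n B b c → MemBinfty n B a c) ∧
       (¬ MemBinfty n B a b → ¬ MemBinfty n B b c → ¬ MemBinfty n B a c)) := by
  intro a b c hab hbc' hac
  refine ⟨aux_trans n hn B hbc.1 a b c hac, fun h1 h2 h3 => ?_⟩
  obtain ⟨M, h4⟩ := aux_trans n hn _ hbc.2 a b c hac
    (aux_compl n hn B hBt hbc.2 a b hab h1) (aux_compl n hn B hBt hbc.2 b c hbc' h2)
  obtain ⟨N, h3⟩ := h3
  have hd : n ∣ (c + (|M| + |N| + |c - a|) * n) - c := ⟨|M| + |N| + |c - a|, by ring⟩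
  have hM := le_abs_self M
  have hN := le_abs_self N
  have hM0 := abs_nonneg M
  have hN0 := abs_nonneg N
  have hca := neg_abs_le (c - a)
  have hca0 := abs_nonneg (c - a)
  have hge : |M| + |N| + |c - a| ≤ (|M| + |N| + |c - a|) * n := by nlinarith
  exact (h4 a _ (by simp) hd (by linarith)).2 (h3 a _ (by simp) hd (by linarith))
end

section
/- A subset B ⊆ Φ⁺ is biclosed if and only if there do not exist α, β, γ ∈ D(B) and positive real numbers a, b, c with a·α + b·β + c·γ = 0. -/
/-- Let `Φ⁺ ⊆ V` admit a linear functional which is positive on it, and let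
`B ⊆ Φ⁺`. Then `B` is biclosed if and only if there do not exist
`α, β, γ ∈ D(B) = B ∪ (−(Φ⁺ \ B))` and positive reals `a, b, c` with
`a•α + b•β + c•γ = 0`. -/
theorem biclosed_iff_no_positive_relation {V : Type*} [AddCommGroup V]
    [Module ℝ V] (Φp : Set V) (f : V →ₗ[ℝ] ℝ) (hf : ∀ α ∈ Φp, 0 < f α)
    (B : Set V) (hB : B ⊆ Φp) :
    (∀ α ∈ Φp, ∀ β ∈ Φp, ∀ γ ∈ Φp,
      (∃ a b : ℝ, 0 < a ∧ 0 < b ∧ γ = a • α + b • β) →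
        ((α ∈ B → β ∈ B → γ ∈ B) ∧ (α ∉ B → β ∉ B → γ ∉ B))) ↔
    ¬ ∃ α ∈ B ∪ {x : V | ∃ β ∈ Φp \ B, x = -β},
      ∃ β ∈ B ∪ {x : V | ∃ β ∈ Φp \ B, x = -β},
      ∃ γ ∈ B ∪ {x : V | ∃ β ∈ Φp \ B, x = -β},
      ∃ a b c : ℝ, 0 < a ∧ 0 < b ∧ 0 < c ∧ a • α + b • β + c • γ = 0 := by
  constructor
  · intro h
    have key : ∀ α ∈ Φp, ∀ β ∈ Φp, ∀ γ ∈ Φp, ∀ a b c : ℝ, 0 < a → 0 < b → 0 < c →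
        a • α + b • β = c • γ →
        ((α ∈ B → β ∈ B → γ ∈ B) ∧ (α ∉ B → β ∉ B → γ ∉ B)) := by
      intro α hα β hβ γ hγ a b c ha hb hc e
      refine h α hα β hβ γ hγ ⟨c⁻¹ * a, c⁻¹ * b, by positivity, by positivity, ?_⟩
      rw [mul_smul, mul_smul, ← smul_add, e, inv_smul_smul₀ hc.ne']
    have pos : ∀ α ∈ Φp, ∀ β ∈ Φp, ∀ γ ∈ Φp, ∀ a b c : ℝ, 0 < a → 0 < b → 0 < c →
        a • α + b • β + c • γ ≠ 0 := by
      intro α hα β hβ γ hγ a b c ha hb hc e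
      have e' := congrArg f e
      simp only [map_add, map_smul, smul_eq_mul, map_zero] at e'
      have h1 := mul_pos ha (hf α hα)
      have h2 := mul_pos hb (hf β hβ)
      have h3 := mul_pos hc (hf γ hγ)
      linarith
    rintro ⟨α, hα, β, hβ, γ, hγ, a, b, c, ha, hb, hc, e⟩
    rcases hα with hα | ⟨α, ⟨hα, nα⟩, rfl⟩ <;> rcases hβ with hβ | ⟨β, ⟨hβ, nβ⟩, rfl⟩ <;>
      rcases hγ with hγ | ⟨γ, ⟨hγ, nγ⟩, rfl⟩
    · exact pos α (hB hα) β (hB hβ) γ (hB hγ) a b c ha hb hc e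
    · exact nγ ((key α (hB hα) β (hB hβ) γ hγ a b c ha hb hc
        (by linear_combination (norm := module) (1 : ℝ) • e)).1 hα hβ)
    · exact nβ ((key α (hB hα) γ (hB hγ) β hβ a c b ha hc hb
        (by linear_combination (norm := module) (1 : ℝ) • e)).1 hα hγ)
    · exact (key β hβ γ hγ α (hB hα) b c a hb hc ha
        (by linear_combination (norm := module) (-1 : ℝ) • e)).2 nβ nγ hα
    · exact nα ((key β (hB hβ) γ (hB hγ) α hα b c a hb hc ha
        (by linear_combination (norm := module) (1 : ℝ) • e)).1 hβ hγ)
    · exact (key α hα γ hγ β (hB hβ) a c b ha hc hb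
        (by linear_combination (norm := module) (-1 : ℝ) • e)).2 nα nγ hβ
    · exact (key α hα β hβ γ (hB hγ) a b c ha hb hc
        (by linear_combination (norm := module) (-1 : ℝ) • e)).2 nα nβ hγ
    · exact pos α hα β hβ γ hγ a b c ha hb hc (by linear_combination (norm := module) (-1 : ℝ) • e)
  · rintro h α hα β hβ γ hγ ⟨a, b, ha, hb, e⟩
    constructor
    · intro h1 h2
      by_contra h3
      exact h ⟨α, Or.inl h1, β, Or.inl h2, -γ, Or.inr ⟨γ, ⟨hγ, h3⟩, rfl⟩, a, b, 1, ha, hb,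
        one_pos, by rw [e]; module⟩
    · intro h1 h2 h3
      exact h ⟨-α, Or.inr ⟨α, ⟨hα, h1⟩, rfl⟩, -β, Or.inr ⟨β, ⟨hβ, h2⟩, rfl⟩, γ, Or.inl h3,
        a, b, 1, ha, hb, one_pos, by rw [e]; module⟩
end

section
/- If B and C are commensurable translation-invariant biclosed subsets of T̃, then there exists a finite sequence B = Z₀, Z₁, …, Z_ℓ = C of translation-invariant biclosed subsets of T̃ such that for each t, the symmetric difference of Z_t and Z_{t+1} is a single translation orbit {(i + mn, j + mn) : m ∈ ℤ} for some (i,j) ∈ T̃. -/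
structure Good (n : ℤ) (R : ℤ → ℤ → Prop) : Prop where
  anti : ∀ a b, ¬ n ∣ b - a → (R a b ↔ ¬ R b a)
  shift : ∀ a b, R (a + n) (b + n) ↔ R a b
  trans : ∀ a b c, ¬ n ∣ b - a → ¬ n ∣ c - b → ¬ n ∣ c - a → R a b → R b c → R a c
  mono : ∀ a b, ¬ n ∣ b - a →
    (∀ k l : ℤ, k ≤ l → R a (b + k * n) → R a (b + l * n)) ∨
    (∀ k l : ℤ, k ≤ l → R a (b + l * n) → R a (b + k * n))

theorem ndvd_shift {n a b : ℤ} (k : ℤ) (h : ¬ n ∣ b - a) : ¬ n ∣ (b + k * n) - a := by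
  intro h'
  apply h
  have : b - a = (b + k * n - a) - k * n := by ring
  rw [this]
  exact dvd_sub h' (dvd_mul_left n k)

theorem ndvd_symm {n a b : ℤ} (h : ¬ n ∣ b - a) : ¬ n ∣ a - b := by
  rwa [dvd_sub_comm]

theorem dvd_iff_eq {n a b : ℤ} : n ∣ b - a ↔ ∃ k, b = a + k * n := by
  constructor
  · rintro ⟨k, hk⟩
    exact ⟨k, by linarith⟩
  · rintro ⟨k, rfl⟩
    exact ⟨k, by ring⟩

namespace Good
variable {n : ℤ} {R : ℤ → ℤ → Prop}

theorem shiftm (hR : Good n R) (a b m : ℤ) : R (a + m * n) (b + m * n) ↔ R a b := by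
  induction m using Int.induction_on with
  | zero => simp
  | succ i ih =>
    rw [← ih, ← hR.shift (a + i * n)]
    ring_nf
  | pred i ih =>
    rw [← ih, ← hR.shift (a + (-i - 1) * n)]
    ring_nf

theorem swap (hR : Good n R) : Good n (fun a b => R b a) where
  anti a b h := hR.anti b a (ndvd_symm h)
  shift a b := hR.shift b a
  trans a b c h1 h2 h3 h4 h5 :=
    hR.trans c b a (ndvd_symm h2) (ndvd_symm h1) (ndvd_symm h3) h5 h4
  mono a b h := by
    have key : ∀ k, R (b + k * n) a ↔ ¬ R a (b + k * n) := fun k =>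
      hR.anti _ _ (ndvd_symm (ndvd_shift k h))
    simp only [key]
    rcases hR.mono a b h with h1 | h1
    · right
      intro k l hkl h2 h3
      exact h2 (h1 k l hkl h3)
    · left
      intro k l hkl h2 h3
      exact h2 (h1 k l hkl h3)

end Good

/-- increasing, nonconstant -/
def Inc (n : ℤ) (R : ℤ → ℤ → Prop) (a b : ℤ) : Prop :=
  (∀ k l : ℤ, k ≤ l → R a (b + k * n) → R a (b + l * n)) ∧ ∃ k : ℤ, ¬ R a (b + k * n)

open Classical in
noncomputable def tau (n : ℤ) (R : ℤ → ℤ → Prop) (c x : ℤ) : ℤ :=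
  if n ∣ x - c then (x - c) / n else sSup {k : ℤ | R (c + k * n) x}

noncomputable def pos (n : ℤ) (R : ℤ → ℤ → Prop) (x : ℤ) : ℤ :=
  ∑ c ∈ Finset.Ico 0 n, tau n R c x

section tau
variable {n : ℤ} {R : ℤ → ℤ → Prop}

theorem tau_same (hn : 1 ≤ n) (c k : ℤ) : tau n R c (c + k * n) = k := by
  have : n ∣ c + k * n - c := ⟨k, by ring⟩
  rw [tau, if_pos this]
  have : c + k * n - c = k * n := by ring
  rw [this, Int.mul_ediv_cancel _ (by omega)]

/-- general comparison for sups of sets of integers -/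
theorem sSup_comp (S T : Set ℤ) (m : ℤ) (h1 : S ⊆ T) (h2 : ∀ k ∈ T, k - m ∈ S) :
    sSup S ≤ sSup T := by
  by_cases hS : S.Nonempty
  · by_cases hb : BddAbove S
    · have hbT : BddAbove T := by
        obtain ⟨u, hu⟩ := hb
        refine ⟨u + m, fun k hk => ?_⟩
        have := hu (h2 k hk)
        linarith
      exact csSup_le_csSup hbT hS h1
    · have hbT : ¬ BddAbove T := fun h => hb (h.mono h1)
      rw [Int.csSup_of_not_bddAbove hb, Int.csSup_of_not_bddAbove hbT]
  · have hT : ¬ T.Nonempty := fun ⟨k, hk⟩ => hS ⟨_, h2 k hk⟩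
    rw [Set.not_nonempty_iff_eq_empty] at hS hT
    rw [hS, hT]

theorem tau_lt (hn : 1 ≤ n) (hR : Good n R) {a b c : ℤ} (hab : ¬ n ∣ b - a) (h : R a b)
    (hi : Inc n R a b) (hc : n ∣ b - c) : tau n R c a < tau n R c b := by
  obtain ⟨j, rfl⟩ := dvd_iff_eq.1 hc
  rw [tau_same hn]
  have hac : ¬ n ∣ a - c := by
    have := ndvd_shift (-j) hab
    apply ndvd_symm
    convert this using 2
    ring
  rw [tau, if_neg hac]
  have hlt : ∀ k ∈ {k : ℤ | R (c + k * n) a}, k ≤ j - 1 := by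
    intro k hk
    by_contra hcon
    have h2 := hi.1 0 (k - j) (by omega) (by simpa using h)
    have h3 : c + j * n + (k - j) * n = c + k * n := by ring
    rw [h3] at h2
    exact (hR.anti _ _ (ndvd_shift k (ndvd_symm hac))).1 h2 hk
  have hne : {k : ℤ | R (c + k * n) a}.Nonempty := by
    obtain ⟨k, hk⟩ := hi.2
    refine ⟨j + k, ?_⟩
    have h3 : c + j * n + k * n = c + (j + k) * n := by ring
    rw [h3] at hk
    exact (hR.anti _ _ (ndvd_symm (ndvd_shift _ (ndvd_symm hac)))).2 hk
  have := csSup_le hne hlt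
  omega

theorem tau_le (hn : 1 ≤ n) (hR : Good n R) {a b : ℤ} (c : ℤ) (hab : ¬ n ∣ b - a) (h : R a b)
    (hi : Inc n R a b) : tau n R c a ≤ tau n R c b := by
  by_cases hc : n ∣ b - c
  · exact (tau_lt hn hR hab h hi hc).le
  by_cases hca : n ∣ a - c
  · obtain ⟨j, rfl⟩ := dvd_iff_eq.1 hca
    rw [tau_same hn, tau, if_neg hc]
    apply le_csSup
    · obtain ⟨k, hk⟩ := hi.2
      refine ⟨j - k, fun l hl => ?_⟩
      by_contra hcon
      apply hk
      refine hi.1 (j - l) k (by omega) ?_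
      have := (hR.shiftm _ _ (j - l)).2 hl
      convert this using 1
      ring
    · exact h
  · rw [tau, tau, if_neg hca, if_neg hc]
    obtain ⟨k, hk⟩ := hi.2
    have hk' : R (b + k * n) a := (hR.anti _ _ (ndvd_symm (ndvd_shift _ hab))).2 hk
    apply sSup_comp _ _ (-k)
    · intro l hl
      exact hR.trans _ a _ (ndvd_symm (ndvd_shift _ (ndvd_symm hca))) hab
        (ndvd_symm (ndvd_shift _ (ndvd_symm hc))) hl h
    · intro l hl
      have h1 := (hR.shiftm _ _ k).2 hl
      have h2 : R (c + l * n + k * n) a := by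
        have e : c + l * n + k * n = c + (l + k) * n := by ring
        refine hR.trans _ _ _ ?_ (ndvd_symm (ndvd_shift _ hab)) ?_ h1 hk'
        · rw [e]
          exact ndvd_shift _ (ndvd_symm (ndvd_shift _ (ndvd_symm hc)))
        · rw [e]
          exact (ndvd_symm (ndvd_shift _ (ndvd_symm hca)))
      show R _ _
      convert h2 using 1
      ring

theorem pos_lt (hn : 1 ≤ n) (hR : Good n R) {a b : ℤ} (hab : ¬ n ∣ b - a) (h : R a b)
    (hi : Inc n R a b) : pos n R a < pos n R b := by
  apply Finset.sum_lt_sum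
  · intro c _
    exact tau_le hn hR c hab h hi
  · refine ⟨b % n, ?_, tau_lt hn hR hab h hi ?_⟩
    · simp only [Finset.mem_Ico]
      exact ⟨Int.emod_nonneg _ (by omega), Int.emod_lt_of_pos _ (by omega)⟩
    · exact Int.dvd_self_sub_emod

theorem pos_sub (hn : 1 ≤ n) (hR : Good n R) (b : ℤ) : pos n R (b - n) < pos n R b := by
  apply Finset.sum_lt_sum
  · intro c _
    by_cases hc : n ∣ b - c
    · obtain ⟨j, rfl⟩ := dvd_iff_eq.1 hc
      have : c + j * n - n = c + (j - 1) * n := by ring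
      rw [this, tau_same hn, tau_same hn]
      omega
    · have hc' : ¬ n ∣ b - n - c := by
        have := ndvd_shift (-1) hc
        convert this using 2
        ring
      rw [tau, tau, if_neg hc', if_neg hc]
      have key : ∀ k, R (c + k * n) (b - n) ↔ R (c + (k + 1) * n) b := by
        intro k
        rw [← hR.shift]
        ring_nf
      simp only [key]
      by_cases hS : {k : ℤ | R (c + k * n) b}.Nonempty
      · by_cases hb : BddAbove {k : ℤ | R (c + k * n) b}
        · apply csSup_le
          · obtain ⟨k, hk⟩ := hS
            exact ⟨k - 1, by simpa using hk⟩
          · intro k hk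
            have := le_csSup hb (show k + 1 ∈ _ from hk)
            omega
        · rw [Int.csSup_of_not_bddAbove hb, Int.csSup_of_not_bddAbove]
          rintro ⟨u, hu⟩
          apply hb
          refine ⟨u + 1, fun k hk => ?_⟩
          have := hu (show k - 1 ∈ _ by simpa using hk)
          omega
      · have hT : ¬ {k : ℤ | R (c + (k + 1) * n) b}.Nonempty := fun ⟨k, hk⟩ => hS ⟨_, hk⟩
        rw [Set.not_nonempty_iff_eq_empty] at hS hT
        rw [hS, hT]
  · refine ⟨b % n, ?_, ?_⟩
    · simp only [Finset.mem_Ico]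
      exact ⟨Int.emod_nonneg _ (by omega), Int.emod_lt_of_pos _ (by omega)⟩
    · obtain ⟨j, hj⟩ := dvd_iff_eq.1 (Int.dvd_self_sub_emod : n ∣ b - b % n)
      generalize b % n = c at hj
      subst hj
      have : c + j * n - n = c + (j - 1) * n := by ring
      rw [this, tau_same hn, tau_same hn]
      omega

end tau

/-- the orbit of `(a,b)` -/
def Orb (n a b x y : ℤ) : Prop := ∃ m : ℤ, x = a + m * n ∧ y = b + m * n

def Flip (n a b : ℤ) (R : ℤ → ℤ → Prop) (x y : ℤ) : Prop :=
  (R x y ∧ ¬ Orb n a b x y) ∨ Orb n b a x y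

theorem Orb.shift {n a b x y : ℤ} : Orb n a b (x + n) (y + n) ↔ Orb n a b x y := by
  constructor
  · rintro ⟨m, h1, h2⟩
    exact ⟨m - 1, by linarith, by linarith⟩
  · rintro ⟨m, h1, h2⟩
    exact ⟨m + 1, by linarith, by linarith⟩

theorem Orb.swap {n a b x y : ℤ} : Orb n a b x y ↔ Orb n b a y x := by
  constructor <;> rintro ⟨m, h1, h2⟩ <;> exact ⟨m, h2, h1⟩

theorem not_orb_both {n a b x y : ℤ} (hab : ¬ n ∣ b - a) (h1 : Orb n a b x y)
    (h2 : Orb n b a x y) : False := by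
  obtain ⟨m, h1, _⟩ := h1
  obtain ⟨k, h3, _⟩ := h2
  exact hab ⟨m - k, by linarith⟩

theorem Orb.rel {n a b x y : ℤ} {R : ℤ → ℤ → Prop} (hR : Good n R) (h : Orb n a b x y) :
    R x y ↔ R a b := by
  obtain ⟨m, rfl, rfl⟩ := h
  exact hR.shiftm _ _ _

theorem flip_good {n a b : ℤ} {R : ℤ → ℤ → Prop} (hn : 1 ≤ n) (hR : Good n R)
    (hab : ¬ n ∣ b - a) (h : R a b)
    (hcov : ∀ c, ¬ n ∣ c - a → ¬ n ∣ b - c → R a c → R c b → False)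
    (hinc : ∀ k l : ℤ, k ≤ l → R a (b + k * n) → R a (b + l * n))
    (hmin : ¬ R a (b - n)) : Good n (Flip n a b R) := by
  have hba : ¬ R b a := (hR.anti _ _ hab).1 h
  have anti : ∀ x y, ¬ n ∣ y - x → (Flip n a b R x y ↔ ¬ Flip n a b R y x) := by
    intro x y hxy
    have h1 := hR.anti _ _ hxy
    have h2 := not_orb_both (x := x) (y := y) hab
    have h3 : Orb n a b x y → _ := Orb.rel hR
    have h4 : Orb n b a x y → _ := Orb.rel hR
    unfold Flip
    rw [Orb.swap (x := y) (y := x), Orb.swap (a := b) (b := a) (x := y) (y := x)]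
    tauto
  have key : ∀ k : ℤ, Flip n a b R a (b + k * n) ↔ 1 ≤ k := by
    intro k
    have hk0 : Orb n a b a (b + k * n) ↔ k = 0 := by
      constructor
      · rintro ⟨m, h1, h2⟩
        have hm : m * n = 0 := by linarith
        have hm : k * n = 0 := by linarith
        rcases mul_eq_zero.1 hm with h | h
        · exact h
        · omega
      · rintro rfl
        exact ⟨0, by simp, by simp⟩
    have hno : ¬ Orb n b a a (b + k * n) := by
      rintro ⟨m, h1, h2⟩
      exact hab ⟨-m, by linarith⟩
    unfold Flip
    rw [hk0]
    constructor
    · rintro (⟨h1, h2⟩ | h1)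
      · by_contra hcon
        apply hmin
        have := hinc k (-1) (by omega) h1
        convert this using 1
        ring
      · exact absurd h1 hno
    · intro hk
      refine Or.inl ⟨?_, by omega⟩
      exact hinc 0 k (by omega) (by simpa using h)
  have shift : ∀ x y, Flip n a b R (x + n) (y + n) ↔ Flip n a b R x y := by
    intro x y
    unfold Flip
    rw [hR.shift, Orb.shift, Orb.shift]
  have shiftm : ∀ x y m, Flip n a b R (x + m * n) (y + m * n) ↔ Flip n a b R x y := by
    intro a b m
    induction m using Int.induction_on with
    | zero => simp
    | succ i ih =>
      rw [← ih, ← shift (a + i * n)]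
      ring_nf
    | pred i ih =>
      rw [← ih, ← shift (a + (-i - 1) * n)]
      ring_nf
  refine ⟨anti, shift, ?_, ?_⟩
  · intro x y z hxy hyz hxz h1 h2
    rcases h1 with ⟨h1, h1'⟩ | h1
    · rcases h2 with ⟨h2, h2'⟩ | h2
      · left
        refine ⟨hR.trans _ _ _ hxy hyz hxz h1 h2, ?_⟩
        rintro ⟨m, rfl, rfl⟩
        have e : y = (y + (-m) * n) + m * n := by ring
        rw [e] at h1 h2
        rw [hR.shiftm] at h1 h2
        refine hcov _ ?_ ?_ h1 h2
        · intro hd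
          apply hxy
          convert hd using 1
          ring
        · intro hd
          apply hyz
          convert hd using 1
          ring
      · left
        obtain ⟨m, rfl, rfl⟩ := h2
        constructor
        · by_contra hcon
          rw [hR.anti _ _ hxz, not_not] at hcon
          have e : x = (x + (-m) * n) + m * n := by ring
          rw [e] at h1 hcon
          rw [hR.shiftm] at h1 hcon
          refine hcov _ ?_ ?_ hcon h1
          · intro hd
            apply ndvd_symm hxz
            convert hd using 1
            ring
          · intro hd
            apply hxy
            convert hd using 1
            ring
        · rintro ⟨m', h3, h4⟩
          apply hxz
          rw [h3]
          exact dvd_iff_eq.2 ⟨m - m', by ring⟩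
    · rcases h2 with ⟨h2, h2'⟩ | h2
      · left
        obtain ⟨m, rfl, rfl⟩ := h1
        constructor
        · by_contra hcon
          rw [hR.anti _ _ hxz, not_not] at hcon
          have e : z = (z + (-m) * n) + m * n := by ring
          rw [e] at h2 hcon
          rw [hR.shiftm] at h2 hcon
          refine hcov _ ?_ ?_ h2 hcon
          · intro hd
            apply hyz
            convert hd using 1
            ring
          · intro hd
            apply ndvd_symm hxz
            convert hd using 1
            ring
        · rintro ⟨m', h3, h4⟩
          apply hxz
          rw [h4]
          exact dvd_iff_eq.2 ⟨m' - m, by ring⟩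
      · exfalso
        obtain ⟨m, rfl, rfl⟩ := h1
        obtain ⟨m', h3, h4⟩ := h2
        exact hab ⟨m - m', by linarith⟩
  · intro x y hxy
    by_cases hO : ∃ p q : ℤ, x = a + p * n ∧ y = b + q * n
    · obtain ⟨p, q, rfl, rfl⟩ := hO
      left
      have e : ∀ k : ℤ, b + q * n + k * n = (b + (q - p + k) * n) + p * n := by
        intro k; ring
      intro k l hkl
      rw [e, e, shiftm, shiftm, key, key]
      omega
    by_cases hO' : ∃ p q : ℤ, x = b + p * n ∧ y = a + q * n
    · obtain ⟨p, q, rfl, rfl⟩ := hO'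
      left
      have e : ∀ k : ℤ, Flip n a b R (b + p * n) (a + q * n + k * n) ↔ ¬ (1 ≤ p - q - k) := by
        intro k
        rw [anti _ _ (ndvd_shift k hxy), ← key, ← shiftm a _ (q + k)]
        ring_nf
      intro k l hkl
      rw [e, e]
      omega
    have hnO : ∀ k, ¬ Orb n a b x (y + k * n) := by
      rintro k ⟨m, h1, h2⟩
      exact hO ⟨m, m - k, h1, by linarith⟩
    have hnO' : ∀ k, ¬ Orb n b a x (y + k * n) := by
      rintro k ⟨m, h1, h2⟩
      exact hO' ⟨m, m - k, h1, by linarith⟩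
    simp only [Flip, hnO, hnO', not_false_eq_true, and_true, or_false]
    exact hR.mono x y hxy

theorem nonconst {n : ℤ} {R R' : ℤ → ℤ → Prop} (hn : 1 ≤ n) (hR' : Good n R')
    {M : ℤ} (hM : ∀ a b, ¬ n ∣ b - a → M < |b - a| → (R a b ↔ R' a b))
    {a b : ℤ} (hab : ¬ n ∣ b - a) (h' : ¬ R' a b) : 
    (∃ k, 0 ≤ k ∧ ¬ R a (b + k * n)) ∨ (∃ k, k ≤ 0 ∧ ¬ R a (b + k * n)) := by
  have hbig : ∀ k : ℤ, |M| + |b - a| + 1 ≤ |k| → (R a (b + k * n) ↔ R' a (b + k * n)) := by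
    intro k hk
    apply hM _ _ (ndvd_shift k hab)
    have h1 : |k| ≤ |k * n| := by
      rw [abs_mul]
      have : 1 ≤ |n| := by rw [abs_of_pos (by omega)]; exact hn
      nlinarith [abs_nonneg k]
    have h2 : |k * n| ≤ |b + k * n - a| + |b - a| := by
      rcases abs_cases (k * n) with ⟨h3, _⟩ | ⟨h3, _⟩ <;>
      rcases abs_cases (b + k * n - a) with ⟨h4, _⟩ | ⟨h4, _⟩ <;>
      rcases abs_cases (b - a) with ⟨h5, _⟩ | ⟨h5, _⟩ <;> linarith
    have := le_abs_self M
    omega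
  have hp : 0 ≤ |M| + |b - a| + 1 := by positivity
  rcases hR'.mono a b hab with h1 | h1
  · right
    refine ⟨-(|M| + |b - a| + 1), by omega, ?_⟩
    rw [hbig]
    · intro h2
      exact h' (by simpa using h1 _ 0 (by omega) h2)
    · rw [abs_neg]; exact le_abs_self _
  · left
    refine ⟨(|M| + |b - a| + 1), by omega, ?_⟩
    rw [hbig]
    · intro h2
      exact h' (by simpa using h1 0 _ (by omega) h2)
    · exact le_abs_self _

theorem main_inc {n : ℤ} {R R' : ℤ → ℤ → Prop} (hn : 1 ≤ n) (hR : Good n R) (hR' : Good n R')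
    {M : ℤ} (hM : ∀ a b, ¬ n ∣ b - a → M < |b - a| → (R a b ↔ R' a b))
    (hex : ∃ a b, ¬ n ∣ b - a ∧ R a b ∧ ¬ R' a b ∧ Inc n R a b) :
    ∃ a b, ¬ n ∣ b - a ∧ R a b ∧ ¬ R' a b ∧ Good n (Flip n a b R) := by
  classical
  have hex' : ∃ N : ℕ, ∃ a b, (¬ n ∣ b - a ∧ R a b ∧ ¬ R' a b ∧ Inc n R a b) ∧
      pos n R b - pos n R a = N := by
    obtain ⟨a, b, h1, h2, h3, h4⟩ := hex
    have := pos_lt hn hR h1 h2 h4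
    exact ⟨(pos n R b - pos n R a).toNat, a, b, ⟨h1, h2, h3, h4⟩, by omega⟩
  obtain ⟨a, b, ⟨hab, h, h', hi⟩, hN⟩ := Nat.find_spec hex'
  have hmin : ∀ x y, ¬ n ∣ y - x → R x y → ¬ R' x y → Inc n R x y →
      pos n R y - pos n R x < pos n R b - pos n R a → False := by
    intro x y h1 h2 h3 h4 h5
    have h6 := pos_lt hn hR h1 h2 h4
    refine Nat.find_min hex' (m := (pos n R y - pos n R x).toNat) ?_
      ⟨x, y, ⟨h1, h2, h3, h4⟩, by omega⟩
    omega
  obtain ⟨k0, hk0⟩ := hi.2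
  have hk0' : k0 ≤ 0 := by
    by_contra hcon
    exact hk0 (hi.1 0 k0 (by omega) (by simpa using h))
  refine ⟨a, b, hab, h, h', flip_good hn hR hab h ?_ hi.1 ?_⟩
  · intro c hac hcb h1 h2
    have hi1 : Inc n R a c := by
      have hno : ¬ R a (c + k0 * n) := by
        intro h3
        exact hk0 (hR.trans _ _ _ (ndvd_shift _ hac)
          (by convert hcb using 2; ring) (ndvd_shift _ hab) h3 ((hR.shiftm _ _ k0).2 h2))
      refine ⟨?_, k0, hno⟩
      rcases hR.mono a c hac with h4 | h4
      · exact h4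
      · exact absurd (h4 k0 0 hk0' (by simpa using h1)) hno
    have hi2 : Inc n R c b := by
      have hno : ¬ R c (b + k0 * n) := by
        intro h3
        exact hk0 (hR.trans _ _ _ hac (ndvd_shift _ hcb) (ndvd_shift _ hab) h1 h3)
      refine ⟨?_, k0, hno⟩
      rcases hR.mono c b hcb with h4 | h4
      · exact h4
      · exact absurd (h4 k0 0 hk0' (by simpa using h2)) hno
    have p1 := pos_lt hn hR hac h1 hi1
    have p2 := pos_lt hn hR hcb h2 hi2
    by_cases h3 : R' a c
    · by_cases h4 : R' c b
      · exact h' (hR'.trans _ _ _ hac hcb hab h3 h4)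
      · exact hmin c b hcb h2 h4 hi2 (by omega)
    · exact hmin a c hac h1 h3 hi1 (by omega)
  · intro h1
    have hab' : ¬ n ∣ b - n - a := by
      have := ndvd_shift (-1) hab
      convert this using 2
      ring
    have e : ∀ k : ℤ, b - n + k * n = b + (k - 1) * n := by intro k; ring
    have p1 := pos_sub hn hR b
    refine hmin a (b - n) hab' h1 ?_ ⟨?_, k0 + 1, ?_⟩ (by omega)
    · intro h2
      rcases hR'.mono a b hab with h3 | h3
      · refine h' ?_
        have := h3 (-1) 0 (by omega) (by convert h2 using 1; ring)
        simpa using this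
      · -- antitone: all later ones are false for R', true for R
        have hf : ∀ k : ℤ, 0 ≤ k → ¬ R' a (b + k * n) := by
          intro k hk h4
          exact h' (by simpa using h3 0 k hk h4)
        have ht : ∀ k : ℤ, 0 ≤ k → R a (b + k * n) := by
          intro k hk
          exact hi.1 0 k hk (by simpa using h)
        have hk : 0 ≤ |M| + |b - a| + 1 := by positivity
        refine hf _ hk ((hM _ _ (ndvd_shift _ hab) ?_).1 (ht _ hk))
        have h5 := le_abs_self M
        have h6 := neg_abs_le (b - a)
        have h7 := le_abs_self (b + (|M| + |b - a| + 1) * n - a)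
        nlinarith
    · intro k l hkl
      rw [e, e]
      exact hi.1 _ _ (by omega)
    · rw [e]
      simpa using hk0

theorem flip_swap {n a b : ℤ} {R : ℤ → ℤ → Prop} (x y : ℤ) : Flip n b a (fun a b => R b a) x y ↔ Flip n a b R y x := by
  unfold Flip
  rw [Orb.swap (a := b) (x := x), Orb.swap (a := a) (x := x)]

theorem main_step {n : ℤ} {R R' : ℤ → ℤ → Prop} (hn : 1 ≤ n) (hR : Good n R) (hR' : Good n R')
    {M : ℤ} (hM : ∀ a b, ¬ n ∣ b - a → M < |b - a| → (R a b ↔ R' a b))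
    (hex : ∃ a b, ¬ n ∣ b - a ∧ R a b ∧ ¬ R' a b) :
    ∃ a b, ¬ n ∣ b - a ∧ R a b ∧ ¬ R' a b ∧ Good n (Flip n a b R) := by
  obtain ⟨a, b, hab, h, h'⟩ := hex
  have hnc : ∃ k, ¬ R a (b + k * n) := by
    rcases nonconst hn hR' hM hab h' with ⟨k, -, hk⟩ | ⟨k, -, hk⟩ <;> exact ⟨k, hk⟩
  rcases hR.mono a b hab with h1 | h1
  · exact main_inc hn hR hR' hM ⟨a, b, hab, h, h', h1, hnc⟩
  · have hba := ndvd_symm hab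
    have := main_inc (R := fun a b => R b a) (R' := fun a b => R' b a) (M := M) hn
      hR.swap hR'.swap
      (by
        intro a b h2 h3
        exact hM b a (ndvd_symm h2) (by rwa [abs_sub_comm]))
      ⟨b, a, hba, h, h', by
        have key : ∀ k : ℤ, R (a + k * n) b ↔ R a (b + (-k) * n) := by
          intro k
          rw [← hR.shiftm a _ k]
          ring_nf
        refine ⟨?_, ?_⟩
        · intro k l hkl
          simp only [key]
          exact h1 _ _ (by omega)
        · obtain ⟨k, hk⟩ := hnc
          refine ⟨-k, ?_⟩
          simp only [key]
          simpa using hk⟩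
    obtain ⟨x, y, hxy, h2, h3, h4⟩ := this
    refine ⟨y, x, ndvd_symm hxy, h2, h3, ?_⟩
    have h5 := h4.swap
    have e : (fun a b => Flip n x y (fun a b => R b a) b a) = Flip n y x R := by
      funext p q
      simp only [eq_iff_iff]
      exact flip_swap q p
    rwa [e] at h5

/-- the relation of a set -/
def RelB (B : Set (ℤ × ℤ)) (a b : ℤ) : Prop :=
  (a < b ∧ (a, b) ∉ B) ∨ (b < a ∧ (b, a) ∈ B)

def OfRel (n : ℤ) (R : ℤ → ℤ → Prop) : Set (ℤ × ℤ) := {p | p ∈ Ttil n ∧ ¬ R p.1 p.2}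

theorem ofRel_closed {n : ℤ} {R : ℤ → ℤ → Prop} (hn : 1 ≤ n) (hR : Good n R) :
    IsClosedT n (OfRel n R) := by
  refine ⟨fun p hp => hp.1, ?_, ?_, ?_⟩
  · rintro i j k hij hjk hik ⟨⟨_, h1⟩, h2⟩ ⟨⟨_, h3⟩, h4⟩
    refine ⟨⟨by simp; omega, hik⟩, ?_⟩
    simp only at *
    intro h5
    apply h4
    exact hR.trans _ i _ (ndvd_symm h1) hik h3 (by
      rw [hR.anti _ _ (ndvd_symm h1)]; exact h2) h5
  · rintro i j k hij hjk hik ⟨⟨_, h1⟩, h2⟩ ⟨⟨_, h3⟩, h4⟩ l hl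
    obtain ⟨m, rfl⟩ := dvd_iff_eq.1 hik
    have hmono := hR.mono i j h1
    have hln : 0 ≤ l * n := by positivity
    have hm : 0 ≤ m := by
      by_contra hcon
      nlinarith
    simp only at *
    have key : ∀ t : ℤ, ¬ R j (i + t * n) ↔ R i (j + (-t) * n) := by
      intro t
      rw [← hR.anti _ _ (ndvd_symm (ndvd_shift t (ndvd_symm h1))), ← hR.shiftm i _ t]
      ring_nf
    have e : i + m * n + l * n = i + (m + l) * n := by ring
    rw [key] at h4
    have hanti : ∀ k l : ℤ, k ≤ l → R i (j + l * n) → R i (j + k * n) := by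
      rcases hmono with h5 | h5
      · exact absurd (by simpa using h5 (-m) 0 (by omega) h4) h2
      · exact h5
    refine ⟨⟨⟨by simp only; omega, ndvd_shift l h1⟩, ?_⟩, ⟨⟨by simp only; omega, ndvd_shift l h3⟩, ?_⟩⟩
    · intro h6
      exact h2 (by simpa using hanti 0 l hl h6)
    · show ¬ R j (i + m * n + l * n)
      rw [e, key]
      exact hanti _ _ (by omega) h4
  · rintro i j k hij hjk hjk' ⟨⟨_, h1⟩, h2⟩ ⟨⟨_, h3⟩, h4⟩ l hl hlk
    obtain ⟨m, rfl⟩ := dvd_iff_eq.1 hjk'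
    have hlm : l ≤ m := by
      by_contra hcon
      nlinarith
    have hln : 0 ≤ l * n := by positivity
    simp only at *
    refine ⟨⟨by simp only; omega, ndvd_shift l h1⟩, ?_⟩
    intro h6
    rcases hR.mono i j h1 with h5 | h5
    · exact h4 (h5 _ _ hlm h6)
    · exact h2 (by simpa using h5 0 _ hl h6)

theorem ofRel_biclosed {n : ℤ} {R : ℤ → ℤ → Prop} (hn : 1 ≤ n) (hR : Good n R) :
    IsBiclosedT n (OfRel n R) := by
  refine ⟨ofRel_closed hn hR, ?_⟩
  have e : Ttil n \ OfRel n R = OfRel n (fun a b => R b a) := by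
    ext ⟨x, y⟩
    constructor
    · rintro ⟨h1, h2⟩
      refine ⟨h1, ?_⟩
      have h3 := hR.anti _ _ h1.2
      simp only [OfRel, Set.mem_ofPred_eq, not_and, not_not] at h2 h3 ⊢
      exact h3.1 (h2 h1)
    · rintro ⟨h1, h2⟩
      refine ⟨h1, ?_⟩
      have h3 := hR.anti _ _ h1.2
      simp only [OfRel, Set.mem_ofPred_eq, not_and, not_not] at h2 h3 ⊢
      intro _
      exact h3.2 h2
  unfold IsCoclosedT
  rw [e]
  exact ofRel_closed hn hR.swap

theorem ofRel_transInv {n : ℤ} {R : ℤ → ℤ → Prop} (hR : Good n R) : TransInv n (OfRel n R) := by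
  intro i j
  simp only [OfRel, Ttil, Set.mem_ofPred_eq, hR.shift]
  have e : j + n - (i + n) = j - i := by ring
  rw [e]
  simp

theorem one_change {P f : ℤ → Prop} (hP : ∀ k l, k ≤ l → P k → P l)
    (h2 : ∀ p q r, ¬ P p → P q → f p → ¬ f q → (r ≤ p → f r) ∧ (q ≤ r → ¬ f r))
    (h2' : ∀ p q r, ¬ P p → P q → ¬ f p → f q → (r ≤ p → ¬ f r) ∧ (q ≤ r → f r))
    (h3 : ∀ p q r, P p → p ≤ r → r ≤ q → f p → f q → f r)
    (h3' : ∀ p q r, P p → p ≤ r → r ≤ q → ¬ f p → ¬ f q → ¬ f r)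
    (h4 : ∀ p q r, ¬ P q → p ≤ r → r ≤ q → f p → f q → f r)
    (h4' : ∀ p q r, ¬ P q → p ≤ r → r ≤ q → ¬ f p → ¬ f q → ¬ f r) :
    (∀ k l, k ≤ l → f k → f l) ∨ (∀ k l, k ≤ l → f l → f k) := by
  by_contra hcon
  push Not at hcon
  obtain ⟨⟨x, y, hxy, hx, hy⟩, z, w, hzw, hw, hz⟩ := hcon
  have e1 := hP x y hxy
  have e2 := hP z w hzw
  by_cases px : P x
  · have py := e1 px
    by_cases pz : P z
    · rcases le_total y w with h | h
      · exact hy (h3 x w y px hxy h hx hw)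
      · exact h3' z y w pz hzw h hz hy hw
    · exact hy ((h2' z x y pz px hz hx).2 hxy)
  · by_cases pw : P w
    · by_cases pz : P z
      · exact (h2 x z w px pz hx hz).2 hzw hw
      · by_cases py : P y
        · rcases le_total y w with h | h
          · exact (h2 x y w px py hx hy).2 h hw
          · exact hy ((h2' z w y pz pw hz hw).2 h)
        · rcases le_total z x with h | h
          · exact (h2' z w y pz pw hz hw).1 |> fun _ => by
              rcases le_total y z with h5 | h5
              · exact (h2' z w x pz pw hz hw).1 (hxy.trans h5) hx
              · exact (h4' z y x py h hxy hz hy) hx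
          · exact (h2' z w x pz pw hz hw).1 h hx
    · have pz : ¬ P z := fun h => pw (e2 h)
      by_cases py : P y
      · exact hz ((h2 w y z pw py hw hy).1 hzw)
      · rcases le_total z x with h | h
        · exact h4' z y x py h hxy hz hy hx
        · exact hz (h4 x w z pw h hzw hx hw)

theorem TransInv.shiftm {n : ℤ} {B : Set (ℤ × ℤ)} (hB : TransInv n B) (i j m : ℤ) :
    (i + m * n, j + m * n) ∈ B ↔ (i, j) ∈ B := by
  induction m using Int.induction_on with
  | zero => simp
  | succ k ih =>
    rw [← ih, hB (i + k * n)]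
    ring_nf
  | pred k ih =>
    rw [← ih, hB (i + (-k - 1) * n)]
    ring_nf

theorem relB_mono {n : ℤ} (hn : 1 ≤ n) {B : Set (ℤ × ℤ)} (hBt : TransInv n B)
    (hbc : IsBiclosedT n B) (a b : ℤ) (hab : ¬ n ∣ b - a) :
    (∀ k l : ℤ, k ≤ l → RelB B a (b + k * n) → RelB B a (b + l * n)) ∨
    (∀ k l : ℤ, k ≤ l → RelB B a (b + l * n) → RelB B a (b + k * n)) := by
  obtain ⟨⟨_, -, B2, B3⟩, ⟨_, -, C2, C3⟩⟩ := hbc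
  have hne : ∀ k : ℤ, b + k * n ≠ a := fun k hk => ndvd_shift k hab (by rw [hk]; simp)
  have fP : ∀ k : ℤ, a < b + k * n → (RelB B a (b + k * n) ↔ (a, b + k * n) ∉ B) := by
    intro k hk
    unfold RelB
    have : ¬ (b + k * n < a) := by omega
    tauto
  have fN : ∀ k : ℤ, ¬ a < b + k * n → (RelB B a (b + k * n) ↔ (b, a + (-k) * n) ∈ B) := by
    intro k hk
    have h1 : b + k * n < a := lt_of_le_of_ne (not_lt.1 hk) (hne k)
    rw [← hBt.shiftm b _ k]
    have : a + -k * n + k * n = a := by ring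
    rw [this]
    unfold RelB
    tauto
  have hdv : ∀ p q : ℤ, n ∣ (b + q * n) - (b + p * n) := fun p q => ⟨q - p, by ring⟩
  have hle : ∀ p q : ℤ, p ≤ q → p * n ≤ q * n := fun p q h =>
    mul_le_mul_of_nonneg_right h (by omega)
  have T1 : ∀ k : ℤ, a < b + k * n → (a, b + k * n) ∈ Ttil n := fun k hk =>
    ⟨hk, ndvd_shift k hab⟩
  have T2 : ∀ k : ℤ, ¬ a < b + k * n → (b, a + (-k) * n) ∈ Ttil n := fun k hk =>
    ⟨by have h1 : b + k * n < a := lt_of_le_of_ne (not_lt.1 hk) (hne k)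
        simp only; linarith, ndvd_shift (-k) (ndvd_symm hab)⟩
  -- the closure condition (2), specialised
  have gen2 : ∀ X : Set (ℤ × ℤ), (∀ i j k : ℤ, i < j → j < k → (n ∣ (k - i)) →
      (i, j) ∈ X → (j, k) ∈ X →
      ∀ l : ℤ, 0 ≤ l → (i, j + l * n) ∈ X ∧ (j, k + l * n) ∈ X) → 
      (∀ i j m, (i + m * n, j + m * n) ∈ X ↔ (i, j) ∈ X) →
      ∀ p q r : ℤ, ¬ a < b + p * n → a < b + q * n → (b, a + (-p) * n) ∈ X →
      (a, b + q * n) ∈ X → (r ≤ p → (b, a + (-r) * n) ∈ X) ∧ (q ≤ r → (a, b + r * n) ∈ X) := by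
    intro X hX hXt p q r hp hq h1 h2
    have hp' : b + p * n < a := lt_of_le_of_ne (not_lt.1 hp) (hne p)
    have h1' : (b + p * n, a) ∈ X := by
      rw [← hXt _ _ p] at h1
      have : a + -p * n + p * n = a := by ring
      rwa [this] at h1
    have main := hX _ _ _ hp' hq (hdv p q) h1' h2
    constructor
    · intro hr
      have := (main (p - r) (by omega)).1
      rw [← hXt _ _ p]
      convert this using 2
      ring
    · intro hr
      have := (main (r - q) (by omega)).2
      convert this using 2
      ring
  have gen3 : ∀ X : Set (ℤ × ℤ), (∀ i j k : ℤ, i < j → j < k → (n ∣ (k - j)) →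
      (i, j) ∈ X → (i, k) ∈ X →
      ∀ l : ℤ, 0 ≤ l → j + l * n ≤ k → (i, j + l * n) ∈ X) →
      ∀ x y p q r : ℤ, x < y + p * n → p ≤ r → r ≤ q → (x, y + p * n) ∈ X →
      (x, y + q * n) ∈ X → (x, y + r * n) ∈ X := by
    intro X hX x y p q r hp hpr hrq h1 h2
    rcases eq_or_lt_of_le (hpr.trans hrq) with h | h
    · have : r = p := by omega
      rw [this]; exact h1
    have h3 : y + p * n < y + q * n := by nlinarith
    have := hX _ _ _ hp h3 ⟨q - p, by ring⟩ h1 h2 (r - p) (by omega)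
      (by have := hle r q hrq; linarith)
    convert this using 2
    ring
  have hXt : ∀ i j m, (i + m * n, j + m * n) ∈ Ttil n \ B ↔ (i, j) ∈ Ttil n \ B := by
    intro i j m
    have e1 : j + m * n - (i + m * n) = j - i := by ring
    simp only [Set.mem_sdiff, hBt.shiftm, Ttil, Set.mem_ofPred_eq, e1]
    simp
  have hP : ∀ k l : ℤ, k ≤ l → a < b + k * n → a < b + l * n := fun k l hkl hk => by
    have := hle k l hkl; linarith
  apply one_change (P := fun k => a < b + k * n) (f := fun k => RelB B a (b + k * n)) hP
  · intro p q r hp hq h1 h2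
    rw [fN p hp] at h1
    rw [fP q hq, not_not] at h2
    have := gen2 B B2 (fun i j m => hBt.shiftm i j m) p q r hp hq h1 h2
    constructor
    · intro hr
      rw [fN r (fun h => hp (hP r p hr h))]
      exact this.1 hr
    · intro hr
      rw [fP r (hP _ _ hr hq), not_not]
      exact this.2 hr
  · intro p q r hp hq h1 h2
    rw [fN p hp] at h1
    rw [fP q hq] at h2
    have := gen2 _ C2 hXt p q r hp hq ⟨T2 p hp, h1⟩ ⟨T1 q hq, h2⟩
    constructor
    · intro hr
      rw [fN r (fun h => hp (hP r p hr h))]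
      exact (this.1 hr).2
    · intro hr
      rw [fP r (hP _ _ hr hq)]
      exact (this.2 hr).2
  · intro p q r hp hpr hrq h1 h2
    have hr := hP _ _ hpr hp
    have hq := hP _ _ hrq hr
    rw [fP _ hp] at h1
    rw [fP _ hq] at h2
    rw [fP _ hr]
    exact (gen3 _ C3 a b p q r hp hpr hrq ⟨T1 p hp, h1⟩ ⟨T1 q hq, h2⟩).2
  · intro p q r hp hpr hrq h1 h2
    have hr := hP _ _ hpr hp
    have hq := hP _ _ hrq hr
    rw [fP _ hp, not_not] at h1
    rw [fP _ hq, not_not] at h2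
    rw [fP _ hr, not_not]
    exact gen3 _ B3 a b p q r hp hpr hrq h1 h2
  · intro p q r hq hpr hrq h1 h2
    have hr : ¬ a < b + r * n := fun h => hq (hP _ _ hrq h)
    have hp : ¬ a < b + p * n := fun h => hr (hP _ _ hpr h)
    rw [fN _ hp] at h1
    rw [fN _ hq] at h2
    rw [fN _ hr]
    exact gen3 _ B3 b a (-q) (-p) (-r) (T2 q hq).1 (by omega) (by omega) h2 h1
  · intro p q r hq hpr hrq h1 h2
    have hr : ¬ a < b + r * n := fun h => hq (hP _ _ hrq h)
    have hp : ¬ a < b + p * n := fun h => hr (hP _ _ hpr h)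
    rw [fN _ hp] at h1
    rw [fN _ hq] at h2
    rw [fN _ hr]
    exact (gen3 _ C3 b a (-q) (-p) (-r) (T2 q hq).1 (by omega) (by omega)
      ⟨T2 q hq, h2⟩ ⟨T2 p hp, h1⟩).2

theorem relB_good {n : ℤ} (hn : 1 ≤ n) {B : Set (ℤ × ℤ)} (hBt : TransInv n B)
    (hbc : IsBiclosedT n B) : Good n (RelB B) := by
  refine ⟨?_, ?_, ?_, relB_mono hn hBt hbc⟩
  · intro a b hab
    have hne : a ≠ b := by rintro rfl; simp at hab
    unfold RelB
    rcases lt_or_gt_of_ne hne with h | h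
    · have : ¬ b < a := by omega
      tauto
    · have : ¬ a < b := by omega
      tauto
  · intro a b
    unfold RelB
    rw [← hBt a b, ← hBt b a]
    simp
  · obtain ⟨⟨_, B1, -, -⟩, ⟨_, C1, -, -⟩⟩ := hbc
    have C1' : ∀ i j k : ℤ, i < j → j < k → ¬ n ∣ j - i → ¬ n ∣ k - j → ¬ n ∣ k - i →
        (i, j) ∉ B → (j, k) ∉ B → (i, k) ∉ B := by
      intro i j k h1 h2 h3 h4 h5 h6 h7
      exact (C1 i j k h1 h2 h5 ⟨⟨h1, h3⟩, h6⟩ ⟨⟨h2, h4⟩, h7⟩).2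
    intro a b c hab hbc hac h1 h2
    have hne : a ≠ c := by rintro rfl; simp at hac
    have hba := ndvd_symm hab
    have hcb := ndvd_symm hbc
    have hca := ndvd_symm hac
    unfold RelB at *
    rcases h1 with ⟨h1, h1'⟩ | ⟨h1, h1'⟩ <;> rcases h2 with ⟨h2, h2'⟩ | ⟨h2, h2'⟩
    · exact Or.inl ⟨h1.trans h2, C1' a b c h1 h2 hab hbc hac h1' h2'⟩
    · rcases lt_or_gt_of_ne hne with h | h
      · exact Or.inl ⟨h, fun h3 => h1' (B1 a c b h h2 hab h3 h2')⟩
      · refine Or.inr ⟨h, ?_⟩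
        by_contra h3
        exact C1' c a b h h1 hca hab hcb h3 h1' h2'
    · rcases lt_or_gt_of_ne hne with h | h
      · exact Or.inl ⟨h, fun h3 => h2' (B1 b a c h1 h hbc h1' h3)⟩
      · refine Or.inr ⟨h, ?_⟩
        by_contra h3
        exact C1' b c a h2 h hbc hca hba h2' h3 h1'
    · exact Or.inr ⟨h2.trans h1, B1 c b a h2 h1 hca h2' h1'⟩

theorem step {n : ℤ} (hn : 1 ≤ n)
    {B C : Set (ℤ × ℤ)} (hB : B ⊆ Ttil n) (hC : C ⊆ Ttil n)
    (hBt : TransInv n B) (hCt : TransInv n C)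
    (hBbc : IsBiclosedT n B) (hCbc : IsBiclosedT n C)
    (hcomm : {p ∈ (B \ C) ∪ (C \ B) | 0 ≤ p.1 ∧ p.1 < n}.Finite) (hne : B ≠ C) :
    ∃ (B1 : Set (ℤ × ℤ)) (p : ℤ × ℤ), p ∈ Ttil n ∧ (p ∈ B ↔ p ∉ C) ∧ B1 ⊆ Ttil n ∧
      TransInv n B1 ∧ IsBiclosedT n B1 ∧
      ∀ x y, (¬ ((x, y) ∈ B ↔ (x, y) ∈ B1)) ↔ Orb n p.1 p.2 x y := by
  have gB := relB_good hn hBt hBbc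
  have gC := relB_good hn hCt hCbc
  obtain ⟨M, hM⟩ : ∃ M, ∀ p ∈ {p ∈ (B \ C) ∪ (C \ B) | 0 ≤ p.1 ∧ p.1 < n}, p.2 ≤ M := by
    obtain ⟨M, hM⟩ := (hcomm.image Prod.snd).bddAbove
    exact ⟨M, fun p hp => hM ⟨p, hp, rfl⟩⟩
  have hM1 : ∀ x y, M < y - x → ((x, y) ∈ B ↔ (x, y) ∈ C) := by
    intro x y hxy
    by_contra hcon
    have e := Int.emod_add_mul_ediv x n
    have h0 := Int.emod_nonneg x (show n ≠ 0 by omega)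
    have h1 := Int.emod_lt_of_pos x (show 0 < n by omega)
    rw [← hBt.shiftm x y (-(x / n)), ← hCt.shiftm x y (-(x / n))] at hcon
    have e2 : x + -(x / n) * n = x % n := by linarith
    have := hM (x + -(x / n) * n, y + -(x / n) * n) ⟨by
      simp only [Set.mem_union, Set.mem_sdiff]; tauto, by rw [e2]; exact ⟨h0, h1⟩⟩
    simp only at this
    linarith
  have hM2 : ∀ a b, ¬ n ∣ b - a → M < |b - a| → (RelB B a b ↔ RelB C a b) := by
    intro a b hab h
    have hne : a ≠ b := by rintro rfl; simp at hab
    unfold RelB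
    rcases lt_or_gt_of_ne hne with h1 | h1
    · rw [abs_of_pos (by omega)] at h
      have := hM1 a b h
      have h2 : ¬ b < a := by omega
      tauto
    · rw [abs_of_neg (by omega)] at h
      have := hM1 b a (by omega)
      have h2 : ¬ a < b := by omega
      tauto
  have rlt : ∀ (X : Set (ℤ × ℤ)) x y, x < y → (RelB X x y ↔ (x, y) ∉ X) := by
    intro X x y h
    unfold RelB
    have : ¬ y < x := by omega
    tauto
  have rgt : ∀ (X : Set (ℤ × ℤ)) x y, y < x → (RelB X x y ↔ (y, x) ∈ X) := by
    intro X x y h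
    unfold RelB
    have : ¬ x < y := by omega
    tauto
  have hex : ∃ a b, ¬ n ∣ b - a ∧ RelB B a b ∧ ¬ RelB C a b := by
    by_contra hcon
    push Not at hcon
    apply hne
    ext ⟨x, y⟩
    constructor
    · intro h
      have ht := hB h
      have := hcon y x (ndvd_symm ht.2) ((rgt B y x ht.1).2 h)
      exact (rgt C y x ht.1).1 this
    · intro h
      have ht := hC h
      by_contra h1
      have := hcon x y ht.2 ((rlt B x y ht.1).2 h1)
      exact (rlt C x y ht.1).1 this h
  obtain ⟨a, b, hab, h1, h2, hg⟩ := main_step hn gB gC hM2 hex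
  have hne : a ≠ b := by rintro rfl; simp at hab
  have horb : ∀ {u v x y : ℤ}, Orb n u v x y → y - x = v - u := by
    rintro u v x y ⟨m, rfl, rfl⟩
    ring
  have hmem : ∀ x y, (x, y) ∈ OfRel n (Flip n a b (RelB B)) ↔ (x, y) ∈ Ttil n ∧
      ((x, y) ∈ B ∨ Orb n a b x y) ∧ ¬ Orb n b a x y := by
    intro x y
    constructor
    · rintro ⟨h3, h4⟩
      have := rlt B x y h3.1
      refine ⟨h3, ?_⟩
      simp only [Flip] at h4
      tauto
    · rintro ⟨h3, h4⟩
      have := rlt B x y h3.1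
      refine ⟨h3, ?_⟩
      simp only [Flip]
      tauto
  refine ⟨OfRel n (Flip n a b (RelB B)), if a < b then (a, b) else (b, a), ?_, ?_,
    fun p hp => hp.1, ofRel_transInv hg, ofRel_biclosed hn hg, ?_⟩
  · split_ifs with h
    · exact ⟨h, hab⟩
    · exact ⟨by simp only; omega, ndvd_symm hab⟩
  · split_ifs with h
    · rw [rlt _ _ _ h] at h1 h2
      tauto
    · rw [rgt _ _ _ (by omega)] at h1 h2
      tauto
  · intro x y
    rw [hmem]
    have hBT : (x, y) ∈ B → (x, y) ∈ Ttil n := fun h => hB h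
    by_cases h : a < b
    · rw [if_pos h]
      rw [rlt _ _ _ h] at h1
      simp only
      have hO : Orb n a b x y → (x, y) ∈ Ttil n := by
        intro ho
        have := horb ho
        exact ⟨by simp only; omega, by simp only; rw [this]; exact hab⟩
      have hO2 : Orb n b a x y → (x, y) ∉ Ttil n := by
        intro ho ht
        have := horb ho
        have := ht.1
        simp only at this
        omega
      have hO3 : Orb n a b x y → (x, y) ∉ B := by
        rintro ⟨m, rfl, rfl⟩
        rwa [hBt.shiftm]
      tauto
    · rw [if_neg h]
      rw [rgt _ _ _ (by omega)] at h1
      simp only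
      have hO2 : Orb n a b x y → (x, y) ∉ Ttil n := by
        intro ho ht
        have := horb ho
        have := ht.1
        simp only at this
        omega
      have hO3 : Orb n b a x y → (x, y) ∈ B := by
        rintro ⟨m, rfl, rfl⟩
        rwa [hBt.shiftm]
      tauto

/-- If `B` and `C` are commensurable translation-invariant biclosed subsets of
`T̃`, then there is a finite sequence of translation-invariant biclosed sets from
`B` to `C` in which consecutive sets differ by a single translation orbit. -/
theorem path_between_commensurable_biclosed (n : ℤ) (hn : 1 ≤ n)
    (B C : Set (ℤ × ℤ)) (hB : B ⊆ Ttil n) (hC : C ⊆ Ttil n)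
    (hBt : TransInv n B) (hCt : TransInv n C)
    (hBbc : IsBiclosedT n B) (hCbc : IsBiclosedT n C)
    (hcomm : {p ∈ (B \ C) ∪ (C \ B) | 0 ≤ p.1 ∧ p.1 < n}.Finite) :
    ∃ (l : ℕ) (Z : ℕ → Set (ℤ × ℤ)), Z 0 = B ∧ Z l = C ∧
      (∀ t ≤ l, Z t ⊆ Ttil n ∧ TransInv n (Z t) ∧ IsBiclosedT n (Z t)) ∧
      (∀ t < l, ∃ p ∈ Ttil n,
        (Z t \ Z (t + 1)) ∪ (Z (t + 1) \ Z t) =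
          {q : ℤ × ℤ | ∃ m : ℤ, q = (p.1 + m * n, p.2 + m * n)}) := by
  obtain ⟨N, hN⟩ : ∃ N : ℕ, {p ∈ (B \ C) ∪ (C \ B) | 0 ≤ p.1 ∧ p.1 < n}.ncard = N := ⟨_, rfl⟩
  induction N using Nat.strong_induction_on generalizing B with
  | _ N ih =>
    by_cases hne : B = C
    · refine ⟨0, fun _ => B, rfl, hne, fun t _ => ⟨hB, hBt, hBbc⟩, ?_⟩
      intro t ht
      omega
    obtain ⟨B1, p, hp, hpD, hB1, hB1t, hB1bc, hO⟩ :=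
      step hn hB hC hBt hCt hBbc hCbc hcomm hne
    have hsub : {p ∈ (B1 \ C) ∪ (C \ B1) | 0 ≤ p.1 ∧ p.1 < n} ⊂
        {p ∈ (B \ C) ∪ (C \ B) | 0 ≤ p.1 ∧ p.1 < n} := by
      have hD : ∀ x y, Orb n p.1 p.2 x y → ((x, y) ∈ B ↔ (x, y) ∉ C) := by
        rintro x y ⟨m, rfl, rfl⟩
        rw [hBt.shiftm, hCt.shiftm]
        exact hpD
      rw [Set.ssubset_iff_exists]
      refine ⟨?_, ?_⟩
      · rintro ⟨x, y⟩ ⟨h1, h2⟩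
        refine ⟨?_, h2⟩
        have h3 := hO x y
        have h4 := hD x y
        simp only [Set.mem_union, Set.mem_sdiff] at h1 ⊢
        tauto
      · have e := Int.emod_add_mul_ediv p.1 n
        have h0 := Int.emod_nonneg p.1 (show n ≠ 0 by omega)
        have h1 := Int.emod_lt_of_pos p.1 (show 0 < n by omega)
        have e2 : p.1 + -(p.1 / n) * n = p.1 % n := by linarith
        have ho : Orb n p.1 p.2 (p.1 + -(p.1 / n) * n) (p.2 + -(p.1 / n) * n) := ⟨_, rfl, rfl⟩
        have h3 := (hO _ _).2 ho
        have h4 := hD _ _ ho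
        refine ⟨(p.1 + -(p.1 / n) * n, p.2 + -(p.1 / n) * n), ⟨?_, ?_⟩, ?_⟩
        · simp only [Set.mem_union, Set.mem_sdiff]
          tauto
        · rw [e2]; exact ⟨h0, h1⟩
        · rintro ⟨h5, -⟩
          simp only [Set.mem_union, Set.mem_sdiff] at h5
          tauto
    have hlt := Set.ncard_lt_ncard hsub hcomm
    rw [hN] at hlt
    obtain ⟨l, Z, hZ0, hZl, hZ, hZs⟩ :=
      ih _ hlt B1 hB1 hB1t hB1bc (hcomm.subset hsub.subset) rfl
    refine ⟨l + 1, fun t => Nat.casesOn t B Z, rfl, hZl, ?_, ?_⟩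
    · intro t ht
      cases t with
      | zero => exact ⟨hB, hBt, hBbc⟩
      | succ t => exact hZ t (by omega)
    · intro t ht
      cases t with
      | zero =>
        refine ⟨p, hp, ?_⟩
        show (B \ Z 0) ∪ (Z 0 \ B) = _
        rw [hZ0]
        ext ⟨x, y⟩
        have h3 := hO x y
        have h4 : Orb n p.1 p.2 x y ↔ ∃ m : ℤ, (x, y) = (p.1 + m * n, p.2 + m * n) := by
          simp only [Orb, Prod.mk.injEq]
        simp only [Set.mem_union, Set.mem_sdiff, Set.mem_ofPred_eq]
        rw [← h4]
        tauto
      | succ t => exact hZs t (by omega)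
end

section
/- Let f : ℤ/nℤ → ℝ be a function and let S ⊆ ℤ/nℤ be a set such that for all residues a, b with f(a) = f(b), a ∈ S if and only if b ∈ S. Then the set B = {(i,j) ∈ T̃ : f(j mod n) < f(i mod n), or f(i mod n) = f(j mod n) and (i mod n) ∈ S} is a translation-invariant biclosed subset of T̃. -/
theorem ttil_shift (n : ℕ) (i j l : ℤ) (hl : 0 ≤ l) (h : (i, j) ∈ Ttil (n : ℤ)) :
    (i, j + l * n) ∈ Ttil (n : ℤ) := by
  obtain ⟨h1, h2⟩ := h
  have h0 : 0 ≤ l * (n : ℤ) := by positivity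
  refine ⟨?_, fun hd => h2 ?_⟩
  · simp only at h1 ⊢
    omega
  · have h3 := dvd_sub hd (Dvd.intro_left l rfl : (n : ℤ) ∣ l * n)
    have h4 : (i, j + l * n).2 - (i, j + l * (n : ℤ)).1 - l * n = j - i := by
      simp only
      ring
    rwa [h4] at h3

/-- A transitive relation on residues gives a closed set. -/
theorem closed_of_trans (n : ℕ) (R : ZMod n → ZMod n → Prop)
    (hR : ∀ a b c, R a b → R b c → R a c) :
    IsClosedT (n : ℤ) {p : ℤ × ℤ | p ∈ Ttil (n : ℤ) ∧ R (p.1 : ZMod n) (p.2 : ZMod n)} := by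
  refine ⟨fun p hp => hp.1, ?_, ?_, ?_⟩
  · rintro i j k hij hjk hd ⟨_, h1⟩ ⟨_, h2⟩
    exact ⟨⟨hij.trans hjk, hd⟩, hR _ _ _ h1 h2⟩
  · rintro i j k hij hjk hd ⟨t1, h1⟩ ⟨t2, h2⟩ l hl
    exact ⟨⟨ttil_shift n i j l hl t1, by simpa using h1⟩,
      ⟨ttil_shift n j k l hl t2, by simpa using h2⟩⟩
  · rintro i j k hij hjk hd ⟨t1, h1⟩ _ l hl _
    exact ⟨ttil_shift n i j l hl t1, by simpa using h1⟩

/-- Let `f : ℤ/nℤ → ℝ` and `S ⊆ ℤ/nℤ` be such that membership in `S` only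
depends on the value of `f`. Then
`B = {(i,j) ∈ T̃ : f(j) < f(i), or f(i) = f(j) and i ∈ S}` (residues mod `n`)
is a translation-invariant biclosed subset of `T̃`. -/
theorem standard_biclosed_set (n : ℕ) (hn : 1 ≤ n)
    (f : ZMod n → ℝ) (S : Set (ZMod n))
    (hS : ∀ a b : ZMod n, f a = f b → (a ∈ S ↔ b ∈ S)) :
    TransInv (n : ℤ)
      {p : ℤ × ℤ | p ∈ Ttil (n : ℤ) ∧
        (f ((p.2 : ZMod n)) < f ((p.1 : ZMod n)) ∨
          (f ((p.1 : ZMod n)) = f ((p.2 : ZMod n)) ∧ ((p.1 : ZMod n)) ∈ S))} ∧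
    IsBiclosedT (n : ℤ)
      {p : ℤ × ℤ | p ∈ Ttil (n : ℤ) ∧
        (f ((p.2 : ZMod n)) < f ((p.1 : ZMod n)) ∨
          (f ((p.1 : ZMod n)) = f ((p.2 : ZMod n)) ∧ ((p.1 : ZMod n)) ∈ S))} := by
  refine ⟨?_, ?_, ?_⟩
  · intro i j
    simp [Ttil]
  · refine closed_of_trans n (fun a b => f b < f a ∨ (f a = f b ∧ a ∈ S)) ?_
    rintro a b c (h1 | ⟨h1, s1⟩) (h2 | ⟨h2, s2⟩)
    · exact Or.inl (h2.trans h1)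
    · exact Or.inl (h2 ▸ h1)
    · exact Or.inl (h1 ▸ h2)
    · exact Or.inr ⟨h1.trans h2, s1⟩
  · have key := closed_of_trans n (fun a b => ¬ (f b < f a ∨ (f a = f b ∧ a ∈ S))) (by
      intro a b c h1 h2 h3
      push Not at h1 h2
      rcases h3 with h3 | ⟨h3, s3⟩
      · linarith [h1.1, h2.1]
      · have e : f a = f b := le_antisymm h1.1 (h3 ▸ h2.1)
        exact h1.2 e s3)
    unfold IsCoclosedT
    convert key using 1
    ext p
    simp only [Set.mem_diff, Set.mem_setOf_eq]
    tauto
end
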